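/- arXiv:2004.10564 — 7 statements merged into one kernel-verified Lean document; each statement's English description precedes it below -/
import Mathlib

section
/- Let R be a commutative ring, M an R-module, s ≤ r natural numbers, f_1,…,f_s ∈ Hom_R(M,R) and m_1,…,m_r ∈ M. Then in the (r−s)-th exterior power ⋀^{r−s}_R M one has (f_s ∘ ⋯ ∘ f_1)(m_1 ∧ ⋯ ∧ m_r) = Σ_{σ ∈ [r s]} sgn(σ) · det((f_i(m_{σ(j)}))_{1≤i,j≤s}) · m_{σ(s+1)} ∧ ⋯ ∧ m_{σ(r)}. -/
open ExteriorAlgebra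

variable {R M : Type*} [CommRing R] [AddCommGroup M] [Module R M]

/-- The wedge product `m₁ ∧ ⋯ ∧ mₙ`, as an element of the `n`-th exterior power
`⋀[R]^n M` of `M`. -/
noncomputable def wedgeProd (R : Type*) {M : Type*} [CommRing R] [AddCommGroup M]
    [Module R M] (n : ℕ) (v : Fin n → M) : ⋀[R]^n M :=
  ⟨ExteriorAlgebra.ιMulti R n v, ExteriorAlgebra.ιMulti_range R n (Set.mem_range_self v)⟩

/-- Given a family `c` of contraction maps (where for `f : M →ₗ[R] R`, `c k f` is to be
the contraction `⋀[R]^k M →ₗ[R] ⋀[R]^(k-1) M` determined by `f`), and linear functionals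
`f = (f₁, …, f_s)`, this is the iterated contraction `f_s ∘ ⋯ ∘ f₁ : ⋀[R]^k M →ₗ[R] ⋀[R]^(k-s) M`
(the functional `f₁` being applied first). -/
noncomputable def iterContract
    (c : ∀ k : ℕ, (M →ₗ[R] R) → (↥(⋀[R]^k M) →ₗ[R] ↥(⋀[R]^(k - 1) M))) :
    (s : ℕ) → (Fin s → (M →ₗ[R] R)) → (k : ℕ) → (↥(⋀[R]^k M) →ₗ[R] ↥(⋀[R]^(k - s) M))
  | 0, _, _ => LinearMap.id
  | s + 1, f, k =>
      (c (k - s) (f (Fin.last s))).comp (iterContract c s (fun i => f i.castSucc) k)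

theorem coe_contract_congr
    (c : ∀ k : ℕ, (M →ₗ[R] R) → (↥(⋀[R]^k M) →ₗ[R] ↥(⋀[R]^(k - 1) M)))
    (g : M →ₗ[R] R) {k l : ℕ} (hkl : k = l) (x : ⋀[R]^k M) (y : ⋀[R]^l M)
    (hxy : (x : ExteriorAlgebra R M) = y) :
    (c k g x : ExteriorAlgebra R M) = c l g y := by
  subst hkl
  rw [Subtype.ext hxy]

theorem coe_iterContract_succ
    (c : ∀ k : ℕ, (M →ₗ[R] R) → (↥(⋀[R]^k M) →ₗ[R] ↥(⋀[R]^(k - 1) M)))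
    (r s : ℕ) (f : Fin (s + 1) → (M →ₗ[R] R)) (x : ⋀[R]^(r + 1) M) :
    (iterContract c (s + 1) f (r + 1) x : ExteriorAlgebra R M) =
      iterContract c s (fun i => f i.succ) r (c (r + 1) (f 0) x) := by
  induction s with
  | zero => rfl
  | succ s ih =>
    exact coe_contract_congr c (f (Fin.last (s + 1))) (Nat.add_sub_add_right r 1 s) _ _
      (ih fun i => f i.castSucc)

theorem ιMulti_congr {n k : ℕ} (h : n = k) (v : Fin n → M) (w : Fin k → M)
    (hvw : ∀ (i : ℕ) (hn : i < n) (hk : i < k), v ⟨i, hn⟩ = w ⟨i, hk⟩) :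
    ιMulti R n v = ιMulti R k w := by
  subst h
  congr 1
  funext i
  exact hvw i i.2 i.2

/-- The permutation of `Fin (n + 1)` sending `0` to `i` and acting on the remaining entries
as `τ`, followed by the increasing enumeration of the complement of `i`. -/
def consPerm {n : ℕ} (i : Fin (n + 1)) (τ : Equiv.Perm (Fin n)) : Equiv.Perm (Fin (n + 1)) :=
  i.cycleRange⁻¹ * Equiv.Perm.decomposeFin.symm (0, τ)

theorem consPerm_zero {n : ℕ} (i : Fin (n + 1)) (τ : Equiv.Perm (Fin n)) :
    consPerm i τ 0 = i := by
  simp [consPerm, Equiv.Perm.inv_def]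

theorem consPerm_succ {n : ℕ} (i : Fin (n + 1)) (τ : Equiv.Perm (Fin n)) (k : Fin n) :
    consPerm i τ k.succ = i.succAbove (τ k) := by
  simp [consPerm, Equiv.Perm.inv_def]

theorem sign_consPerm {n : ℕ} (i : Fin (n + 1)) (τ : Equiv.Perm (Fin n)) :
    Equiv.Perm.sign (consPerm i τ) = (-1) ^ (i : ℕ) * Equiv.Perm.sign τ := by
  simp [consPerm, Fin.sign_cycleRange]

theorem consPerm_bijective (n : ℕ) :
    Function.Bijective fun p : Fin (n + 1) × Equiv.Perm (Fin n) => consPerm p.1 p.2 := by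
  rw [Fintype.bijective_iff_injective_and_card]
  constructor
  · rintro ⟨i, τ⟩ ⟨i', τ'⟩ h
    have h' : consPerm i τ = consPerm i' τ' := h
    obtain rfl : i = i' := by
      rw [← consPerm_zero i τ, h', consPerm_zero]
    obtain rfl : τ = τ' := Equiv.ext fun k =>
      Fin.succAbove_right_injective (p := i) (by rw [← consPerm_succ, h', consPerm_succ])
    rfl
  · simp [Fintype.card_perm, Nat.factorial_succ]

/-- `σ` is increasing on the entries with index at least `s`. -/
def IncreasingFrom {r : ℕ} (s : ℕ) (σ : Equiv.Perm (Fin r)) : Prop :=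
  ∀ i j : Fin r, s ≤ (i : ℕ) → s ≤ (j : ℕ) → i < j → σ i < σ j

theorem increasingFrom_consPerm {n : ℕ} (s : ℕ) (i : Fin (n + 1)) (τ : Equiv.Perm (Fin n)) :
    IncreasingFrom (s + 1) (consPerm i τ) ↔ IncreasingFrom s τ := by
  constructor
  · intro h a b ha hb hab
    have := h a.succ b.succ (by simpa using ha) (by simpa using hb) (by simpa using hab)
    rw [consPerm_succ, consPerm_succ] at this
    exact (Fin.strictMono_succAbove i).lt_iff_lt.1 this
  · intro h a b ha hb hab
    cases a using Fin.cases with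
    | zero => simp at ha
    | succ a =>
      cases b using Fin.cases with
      | zero => simp at hb
      | succ b =>
        rw [consPerm_succ, consPerm_succ]
        exact Fin.strictMono_succAbove i
          (h a b (by simpa using ha) (by simpa using hb) (by simpa using hab))

theorem increasingFrom_zero {r : ℕ} {σ : Equiv.Perm (Fin r)} :
    IncreasingFrom 0 σ ↔ σ = 1 := by
  constructor
  · intro h
    have hσ : StrictMono σ := fun a b hab => h a b (Nat.zero_le _) (Nat.zero_le _) hab
    have := (hσ.range_inj strictMono_id).1 (by simp [Set.range_eq_univ.2 σ.surjective])
    exact Equiv.ext fun a => congrFun this a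
  · rintro rfl a b - - hab
    exact hab

open Classical in
theorem coe_iterContract_wedgeProd
    (c : ∀ k : ℕ, (M →ₗ[R] R) → (↥(⋀[R]^k M) →ₗ[R] ↥(⋀[R]^(k - 1) M)))
    (hc : ∀ (k : ℕ) (g : M →ₗ[R] R) (v : Fin (k + 1) → M),
        c (k + 1) g (wedgeProd R (k + 1) v) =
          ∑ i : Fin (k + 1), ((-1 : R) ^ (i : ℕ) * g (v i)) •
            wedgeProd R k (fun j => v (i.succAbove j)))
    (r s : ℕ) (hs : s ≤ r) (f : Fin s → (M →ₗ[R] R)) (m : Fin r → M) :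
    (iterContract c s f r (wedgeProd R r m) : ExteriorAlgebra R M) =
      ∑ σ : Equiv.Perm (Fin r) with IncreasingFrom s σ,
        (((Equiv.Perm.sign σ : ℤ) : R) * ∏ j, f j (m (σ (Fin.castLE hs j)))) •
          ιMulti R (r - s) fun j => m (σ ⟨s + j, by omega⟩) := by
  induction s generalizing r with
  | zero =>
    simp only [increasingFrom_zero, Finset.filter_eq', Finset.mem_univ, if_true,
      Finset.sum_singleton]
    simp only [Equiv.Perm.sign_one, Units.val_one, Int.cast_one, Finset.univ_eq_empty,
      Finset.prod_empty, mul_one, one_smul, Equiv.Perm.one_apply]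
    refine ιMulti_congr rfl _ _ fun i hn hk => ?_
    simp
  | succ s ih =>
    obtain _ | r := r
    · omega
    have hs' : s ≤ r := by omega
    rw [coe_iterContract_succ, hc, map_sum, AddSubmonoidClass.coe_finsetSum, Finset.sum_filter,
      ← (consPerm_bijective r).sum_comp, Fintype.sum_prod_type]
    refine Finset.sum_congr rfl fun i _ => ?_
    rw [map_smul, Submodule.coe_smul, ih r hs', Finset.smul_sum, Finset.sum_filter]
    refine Finset.sum_congr rfl fun τ _ => ?_
    simp only [increasingFrom_consPerm]
    refine if_congr Iff.rfl ?_ rfl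
    rw [smul_smul, sign_consPerm, Fin.prod_univ_succ]
    have h0 : consPerm i τ (Fin.castLE hs 0) = i := consPerm_zero i τ
    have hsucc (k : Fin s) : consPerm i τ (Fin.castLE hs k.succ) =
        i.succAbove (τ (Fin.castLE hs' k)) := consPerm_succ i τ (Fin.castLE hs' k)
    simp only [h0, hsucc]
    congr 1
    · push_cast
      ring
    · refine ιMulti_congr (by omega) _ _ fun k hn hk => ?_
      rw [← consPerm_succ]
      congr 2
      ext
      simp only [Fin.val_succ]
      omega

/-- The permutation of `Fin r` acting as `τ` on the first `s` entries and fixing the others. -/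
def headPerm {r s : ℕ} (hs : s ≤ r) (τ : Equiv.Perm (Fin s)) : Equiv.Perm (Fin r) :=
  τ.viaFintypeEmbedding (Fin.castLEEmb hs)

theorem headPerm_castLE {r s : ℕ} (hs : s ≤ r) (τ : Equiv.Perm (Fin s)) (j : Fin s) :
    headPerm hs τ (Fin.castLE hs j) = Fin.castLE hs (τ j) :=
  τ.viaFintypeEmbedding_apply_image (Fin.castLEEmb hs) j

theorem headPerm_of_le {r s : ℕ} (hs : s ≤ r) (τ : Equiv.Perm (Fin s)) {j : Fin r}
    (hj : s ≤ (j : ℕ)) : headPerm hs τ j = j := by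
  refine τ.viaFintypeEmbedding_apply_notMem_range (Fin.castLEEmb hs) ?_
  rintro ⟨i, rfl⟩
  have := i.2
  simp at hj
  omega

theorem sign_headPerm {r s : ℕ} (hs : s ≤ r) (τ : Equiv.Perm (Fin s)) :
    Equiv.Perm.sign (headPerm hs τ) = Equiv.Perm.sign τ :=
  τ.viaFintypeEmbedding_sign (Fin.castLEEmb hs)

theorem perm_ext_castLE {r s : ℕ} (hs : s ≤ r) {σ σ' : Equiv.Perm (Fin r)}
    (head : ∀ j, σ (Fin.castLE hs j) = σ' (Fin.castLE hs j))
    (tail : ∀ j : Fin r, s ≤ (j : ℕ) → σ j = σ' j) : σ = σ' := by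
  ext1 j
  by_cases hj : s ≤ (j : ℕ)
  · exact tail j hj
  · exact head ⟨j, by omega⟩

theorem increasingFrom_mul_headPerm {r s : ℕ} (hs : s ≤ r) (σ : Equiv.Perm (Fin r))
    (τ : Equiv.Perm (Fin s)) (h : IncreasingFrom s σ) :
    IncreasingFrom s (σ * headPerm hs τ) := by
  intro a b ha hb hab
  simpa [headPerm_of_le hs τ ha, headPerm_of_le hs τ hb] using h a b ha hb hab

/-- `σ` is increasing on the first `s` entries and on the remaining ones. -/
def IsShuffle {r : ℕ} (s : ℕ) (σ : Equiv.Perm (Fin r)) : Prop :=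
  (∀ i j : Fin r, (i : ℕ) < s → (j : ℕ) < s → i < j → σ i < σ j) ∧ IncreasingFrom s σ

theorem IsShuffle.strictMono {r s : ℕ} (hs : s ≤ r) {σ : Equiv.Perm (Fin r)}
    (h : IsShuffle s σ) : StrictMono fun j : Fin s => σ (Fin.castLE hs j) :=
  fun a b hab => h.1 _ _ a.2 b.2 hab

open Classical in
theorem sum_increasingFrom_eq_sum_shuffle {A : Type*} [AddCommMonoid A] {r s : ℕ} (hs : s ≤ r)
    (F : Equiv.Perm (Fin r) → A) :
    ∑ σ : Equiv.Perm (Fin r) with IncreasingFrom s σ, F σ =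
      ∑ σ : Equiv.Perm (Fin r) with IsShuffle s σ,
        ∑ τ : Equiv.Perm (Fin s), F (σ * headPerm hs τ) := by
  rw [← Finset.sum_product']
  symm
  refine Finset.sum_nbij (fun p => p.1 * headPerm hs p.2) ?_ ?_ ?_ fun _ _ => rfl
  · rintro ⟨σ, τ⟩ h
    simp only [Finset.mem_product, Finset.mem_filter, Finset.mem_univ, true_and, and_true] at h ⊢
    exact increasingFrom_mul_headPerm hs σ τ h.2
  · rintro ⟨σ, τ⟩ h ⟨σ', τ'⟩ h' heq
    simp only [Finset.coe_product, Set.mem_prod, Finset.mem_coe, Finset.mem_filter,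
      Finset.mem_univ, true_and, and_true] at h h' heq
    have head (j : Fin s) : σ (Fin.castLE hs (τ j)) = σ' (Fin.castLE hs (τ' j)) := by
      simpa [headPerm_castLE] using DFunLike.congr_fun heq (Fin.castLE hs j)
    have tail (j : Fin r) (hj : s ≤ (j : ℕ)) : σ j = σ' j := by
      simpa [headPerm_of_le hs _ hj] using DFunLike.congr_fun heq j
    have hfun := ((h.strictMono hs).range_inj (h'.strictMono hs)).1 (by
      rw [← τ.surjective.range_comp, ← τ'.surjective.range_comp fun j => σ' (Fin.castLE hs j)]
      exact congrArg Set.range (funext head))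
    obtain rfl : σ = σ' := perm_ext_castLE hs (congrFun hfun) tail
    obtain rfl : τ = τ' := Equiv.ext fun j =>
      Fin.castLE_injective hs (σ.injective (head j))
    rfl
  · intro ρ h
    simp only [Finset.coe_filter, Finset.mem_univ, true_and, Set.mem_ofPred_eq] at h
    let g : Fin s → Fin r := fun j => ρ (Fin.castLE hs j)
    have hg : Function.Injective g := ρ.injective.comp (Fin.castLE_injective hs)
    have hmono : StrictMono (g ∘ Tuple.sort g) :=
      (Tuple.monotone_sort g).strictMono_of_injective (hg.comp (Tuple.sort g).injective)
    refine ⟨(ρ * headPerm hs (Tuple.sort g), (Tuple.sort g)⁻¹), ?_, ?_⟩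
    · simp only [Finset.coe_product, Set.mem_prod, Finset.mem_coe, Finset.mem_filter,
        Finset.mem_univ, true_and, and_true]
      refine ⟨fun a b ha hb hab => ?_, increasingFrom_mul_headPerm hs ρ _ h⟩
      have hab' := hmono (show (⟨a, ha⟩ : Fin s) < ⟨b, hb⟩ from hab)
      simp only [Function.comp_apply, g, ← headPerm_castLE] at hab'
      exact hab'
    · refine perm_ext_castLE hs (fun j => ?_) fun j hj => ?_
      · simp [headPerm_castLE]
      · simp [headPerm_of_le hs _ hj]

/-- Let `R` be a commutative ring, `M` an `R`-module, `s ≤ r` natural numbers,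
`f₁,…,f_s ∈ Hom_R(M,R)` and `m₁,…,m_r ∈ M`.  Then, writing `f` also for the contraction
homomorphisms `⋀^k M → ⋀^{k-1} M` determined by `f(m₁ ∧ ⋯ ∧ m_k)
= Σᵢ (−1)^{i+1} f(mᵢ) · m₁ ∧ ⋯ ∧ m̂ᵢ ∧ ⋯ ∧ m_k`, one has, in `⋀^{r-s} M`:
`(f_s ∘ ⋯ ∘ f₁)(m₁ ∧ ⋯ ∧ m_r) = Σ_{σ ∈ [r s]} sgn(σ) ·
det((fᵢ(m_{σ(j)}))_{1≤i,j≤s}) · m_{σ(s+1)} ∧ ⋯ ∧ m_{σ(r)}`,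
where `[r s]` is the set of permutations `σ` of `{1,…,r}` with `σ(1) < ⋯ < σ(s)` and
`σ(s+1) < ⋯ < σ(r)`.  (Indices below are `0`-based.) -/
theorem iterContract_wedgeProd_eq_sum_shuffles
    (c : ∀ k : ℕ, (M →ₗ[R] R) → (↥(⋀[R]^k M) →ₗ[R] ↥(⋀[R]^(k - 1) M)))
    (hc : ∀ (k : ℕ) (g : M →ₗ[R] R) (v : Fin (k + 1) → M),
        c (k + 1) g (wedgeProd R (k + 1) v) =
          ∑ i : Fin (k + 1), ((-1 : R) ^ (i : ℕ) * g (v i)) •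
            wedgeProd R k (fun j => v (i.succAbove j)))
    (r s : ℕ) (hs : s ≤ r) (f : Fin s → (M →ₗ[R] R)) (m : Fin r → M) :
    iterContract c s f r (wedgeProd R r m) =
      ∑ σ ∈ Finset.univ.filter (fun σ : Equiv.Perm (Fin r) =>
          (∀ i j : Fin r, (i : ℕ) < s → (j : ℕ) < s → i < j → σ i < σ j) ∧
          (∀ i j : Fin r, s ≤ (i : ℕ) → s ≤ (j : ℕ) → i < j → σ i < σ j)),
        (((Equiv.Perm.sign σ : ℤ) : R) *
            Matrix.det (Matrix.of fun i j : Fin s => f i (m (σ (Fin.castLE hs j))))) •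
          wedgeProd R (r - s)
            (fun j : Fin (r - s) => m (σ (Fin.cast (Nat.add_sub_cancel' hs) (Fin.natAdd s j)))) := by
  classical
  have hsign (σ : Equiv.Perm (Fin r)) (τ : Equiv.Perm (Fin s)) :
      ((Equiv.Perm.sign (σ * headPerm hs τ) : ℤ) : R) =
        ((Equiv.Perm.sign σ : ℤ) : R) * ((Equiv.Perm.sign τ : ℤ) : R) := by
    simp [sign_headPerm]
  apply Subtype.ext
  rw [coe_iterContract_wedgeProd c hc r s hs, sum_increasingFrom_eq_sum_shuffle hs,
    AddSubmonoidClass.coe_finsetSum]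
  refine Finset.sum_congr (Finset.filter_congr fun σ _ => Iff.rfl) fun σ _ => ?_
  rw [Submodule.coe_smul, ← Matrix.det_transpose, Matrix.det_apply', Finset.mul_sum,
    Finset.sum_smul]
  refine Finset.sum_congr rfl fun τ _ => ?_
  rw [hsign, mul_assoc]
  congr 1
  · simp [headPerm_castLE]
  · refine ιMulti_congr rfl _ _ fun i hn hk => ?_
    rw [Equiv.Perm.mul_apply, headPerm_of_le hs τ (Nat.le_add_right s i)]
    rfl
end

section
/- Let E be a field, W an n-dimensional E-vector space, m a natural number with m ≤ n, and φ_1,…,φ_m ∈ Hom_E(W,E). Set Φ := ⊕_{i=1}^{m} φ_i : W → E^{⊕m}. Then the image of the E-linear map ⋀^n_E W → ⋀^{n−m}_E W given by b ↦ (φ_m ∘ ⋯ ∘ φ_1)(b) is equal to ⋀^{n−m}_E ker(Φ), regarded as a subspace of ⋀^{n−m}_E W via the inclusion ker(Φ) ⊆ W, if Φ is surjective, and is equal to 0 otherwise. -/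
open ExteriorAlgebra

variable {R M : Type*} [CommRing R] [AddCommGroup M] [Module R M]

open Module

/-- The wedge product of a spanning family of `k` vectors spans the `k`-th exterior power. -/
lemma span_ιMulti_of_span_eq_top {k : ℕ} {b : Fin k → M}
    (hb : Submodule.span R (Set.range b) = ⊤) :
    Submodule.span R {ιMulti R k b} = ⋀[R]^k M := by
  apply le_antisymm
  · rw [Submodule.span_singleton_le_iff_mem]
    exact ιMulti_range R k (Set.mem_range_self b)
  · rw [← exteriorPower.ιMulti_span_fixedDegree_of_span_eq_top R k M hb, Submodule.span_le]
    rintro _ ⟨a, ha, rfl⟩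
    choose α hα using fun i => ha (Set.mem_range_self i)
    obtain rfl : b ∘ α = a := funext hα
    by_cases hinj : Function.Injective α
    · obtain ⟨σ, rfl⟩ : ∃ σ : Equiv.Perm (Fin k), ⇑σ = α :=
        ⟨Equiv.ofBijective α (Finite.injective_iff_bijective.mp hinj), rfl⟩
      rw [AlternatingMap.map_perm]
      rcases Int.units_eq_one_or (Equiv.Perm.sign σ) with h | h <;>
        simp [h, Submodule.mem_span_singleton_self]
    · have h0 : ιMulti R k (b ∘ α) = 0 :=
        AlternatingMap.map_eq_zero_of_not_injective _ _ fun h => hinj (Function.Injective.of_comp h)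
      rw [h0]
      exact zero_mem _

lemma span_wedgeProd_of_span_eq_top {k : ℕ} {b : Fin k → M}
    (hb : Submodule.span R (Set.range b) = ⊤) :
    Submodule.span R {wedgeProd R k b} = ⊤ := by
  apply Submodule.map_injective_of_injective (⋀[R]^k M).injective_subtype
  rw [Submodule.map_span, Set.image_singleton, Submodule.map_top, Submodule.range_subtype]
  exact span_ιMulti_of_span_eq_top hb

section Contraction

variable {c : ∀ k : ℕ, (M →ₗ[R] R) → (↥(⋀[R]^k M) →ₗ[R] ↥(⋀[R]^(k - 1) M))}

lemma contract_wedgeProd_tail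
    (hc : ∀ (k : ℕ) (g : M →ₗ[R] R) (v : Fin (k + 1) → M),
      c (k + 1) g (wedgeProd R (k + 1) v) =
        ∑ i : Fin (k + 1), ((-1 : R) ^ (i : ℕ) * g (v i)) •
          wedgeProd R k (fun j => v (i.succAbove j)))
    {k : ℕ} (hk : 0 < k) (g : M →ₗ[R] R) (b : ℕ → M) (s : ℕ)
    (hb : ∀ j, s < j → g (b j) = 0) :
    c k g (wedgeProd R k fun j => b (s + j)) =
      g (b s) • wedgeProd R (k - 1) fun j => b (s + 1 + j) := by
  obtain ⟨k, rfl⟩ := Nat.exists_eq_succ_of_ne_zero hk.ne'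
  rw [Nat.succ_eq_add_one, hc, Fin.sum_univ_succ, Finset.sum_eq_zero]
  · simp [add_assoc, add_comm 1]
  · intro i _
    rw [hb _ (by simp)]
    simp

lemma iterContract_wedgeProd
    (hc : ∀ (k : ℕ) (g : M →ₗ[R] R) (v : Fin (k + 1) → M),
      c (k + 1) g (wedgeProd R (k + 1) v) =
        ∑ i : Fin (k + 1), ((-1 : R) ^ (i : ℕ) * g (v i)) •
          wedgeProd R k (fun j => v (i.succAbove j)))
    {n : ℕ} (b : ℕ → M) :
    ∀ {m : ℕ}, m ≤ n → ∀ φ : Fin m → (M →ₗ[R] R),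
      (∀ i j, φ i (b j) = if (i : ℕ) = j then 1 else 0) →
      iterContract c m φ n (wedgeProd R n fun j => b j) =
        wedgeProd R (n - m) fun j => b (m + j)
  | 0, _, _, _ => by simp [iterContract]
  | m + 1, hm, φ, hφ => by
    change c (n - m) (φ (Fin.last m)) (iterContract c m (fun i => φ i.castSucc) n _) = _
    rw [iterContract_wedgeProd hc b (by omega) _ fun i j => hφ i.castSucc j,
      contract_wedgeProd_tail hc (by omega) _ b m
        fun j hj => by rw [hφ, if_neg]; simpa using hj.ne]
    simp only [hφ, Fin.val_last, if_true, one_smul]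
    rfl

end Contraction

section Field

variable {E W : Type*} [Field E] [AddCommGroup W] [Module E W]

/-- For jointly surjective functionals `φ₁, …, φ_m`, a dual family in `W` extends by a spanning
family of the common kernel to a spanning family of `W` with `dim W` elements. -/
lemma exists_adapted_spanning_family [FiniteDimensional E W] {n m : ℕ} (hn : finrank E W = n)
    {φ : Fin m → (W →ₗ[E] E)} (hφ : Function.Surjective (LinearMap.pi φ)) :
    ∃ b : ℕ → W, (∀ i j, φ i (b j) = if (i : ℕ) = j then 1 else 0) ∧
      Submodule.span E (Set.range fun j : Fin n => b j) = ⊤ ∧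
      ∃ κ : Fin (n - m) → LinearMap.ker (LinearMap.pi φ),
        Submodule.span E (Set.range κ) = ⊤ ∧ ∀ j, (κ j : W) = b (m + j) := by
  have hdim := (LinearMap.pi φ).finrank_range_add_finrank_ker
  rw [LinearMap.range_eq_top.mpr hφ, finrank_top, finrank_fin_fun, hn] at hdim
  let κ : Basis (Fin (n - m)) E (LinearMap.ker (LinearMap.pi φ)) :=
    finBasisOfFinrankEq _ _ (by omega)
  choose v hv using fun i : Fin m => hφ (Pi.single i 1)
  let b : ℕ → W := fun j =>
    if h : j < m then v ⟨j, h⟩ else if h' : j - m < n - m then κ ⟨j - m, h'⟩ else 0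
  have hbv (i : Fin m) : b i = v i := by simp [b]
  have hbκ (j : Fin (n - m)) : (κ j : W) = b (m + j) := by simp [b]
  have hφv (i j : Fin m) : φ i (v j) = if i = j then 1 else 0 := by
    simpa [Pi.single_apply] using congrFun (hv j) i
  have hφκ (i : Fin m) (x : LinearMap.ker (LinearMap.pi φ)) : φ i x = 0 :=
    congrFun (LinearMap.mem_ker.mp x.2) i
  refine ⟨b, fun i j => ?_, ?_, κ, κ.span_eq, hbκ⟩
  · by_cases h : j < m
    · simpa [Fin.ext_iff] using (congrArg (φ i) (hbv ⟨j, h⟩)).trans (hφv i ⟨j, h⟩)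
    · rw [if_neg (by omega)]
      by_cases h' : j - m < n - m
      · simp [b, h, h', hφκ]
      · simp [b, h, h']
  · rw [eq_top_iff]
    intro w _
    have hmem (j : ℕ) (hj : j < n) :
        b j ∈ Submodule.span E (Set.range fun j : Fin n => b j) :=
      Submodule.subset_span ⟨⟨j, hj⟩, rfl⟩
    have hker : LinearMap.ker (LinearMap.pi φ) ≤
        Submodule.span E (Set.range fun j : Fin n => b j) := by
      rw [← Submodule.map_subtype_top (LinearMap.ker (LinearMap.pi φ)), ← κ.span_eq,
        Submodule.map_span, Submodule.span_le]
      rintro _ ⟨_, ⟨j, rfl⟩, rfl⟩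
      rw [Submodule.subtype_apply, hbκ]
      exact hmem _ (by omega)
    have hw : w - ∑ i, φ i w • v i ∈ LinearMap.ker (LinearMap.pi φ) := by
      rw [LinearMap.mem_ker]
      ext i
      simp [hφv]
    rw [← sub_add_cancel w (∑ i, φ i w • v i)]
    refine add_mem (hker hw) (sum_mem fun i _ => Submodule.smul_mem _ _ ?_)
    rw [← hbv]
    exact hmem _ (by omega)

lemma range_iterContract_eq_span [FiniteDimensional E W] {n m : ℕ} (hm : m ≤ n)
    {c : ∀ k : ℕ, (W →ₗ[E] E) → (↥(⋀[E]^k W) →ₗ[E] ↥(⋀[E]^(k - 1) W))}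
    (hc : ∀ (k : ℕ) (g : W →ₗ[E] E) (v : Fin (k + 1) → W),
        c (k + 1) g (wedgeProd E (k + 1) v) =
          ∑ i : Fin (k + 1), ((-1 : E) ^ (i : ℕ) * g (v i)) •
            wedgeProd E k (fun j => v (i.succAbove j)))
    {φ : Fin m → (W →ₗ[E] E)} {b : ℕ → W}
    (hφ : ∀ i j, φ i (b j) = if (i : ℕ) = j then 1 else 0)
    (hb : Submodule.span E (Set.range fun j : Fin n => b j) = ⊤) :
    LinearMap.range (iterContract c m φ n) =
      Submodule.span E {wedgeProd E (n - m) fun j => b (m + j)} := by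
  rw [LinearMap.range_eq_map, ← span_wedgeProd_of_span_eq_top hb, Submodule.map_span,
    Set.image_singleton, iterContract_wedgeProd hc b hm φ hφ]

lemma surjective_pi_of_ne_zero {m : ℕ} {φ : Fin (m + 1) → (W →ₗ[E] E)}
    (hφ : Function.Surjective (LinearMap.pi fun i : Fin m => φ i.castSucc)) {x : W}
    (hx : ∀ i : Fin m, φ i.castSucc x = 0) (hx' : φ (Fin.last m) x ≠ 0) :
    Function.Surjective (LinearMap.pi φ) := by
  intro y
  obtain ⟨u, hu⟩ := hφ fun i => y i.castSucc
  refine ⟨u + ((y (Fin.last m) - φ (Fin.last m) u) / φ (Fin.last m) x) • x, ?_⟩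
  ext i
  refine Fin.lastCases ?_ (fun i => ?_) i
  · simp [hx']
  · simpa [hx] using congrFun hu i

lemma iterContract_eq_zero_of_not_surjective [FiniteDimensional E W] {n : ℕ}
    (hn : finrank E W = n)
    {c : ∀ k : ℕ, (W →ₗ[E] E) → (↥(⋀[E]^k W) →ₗ[E] ↥(⋀[E]^(k - 1) W))}
    (hc : ∀ (k : ℕ) (g : W →ₗ[E] E) (v : Fin (k + 1) → W),
        c (k + 1) g (wedgeProd E (k + 1) v) =
          ∑ i : Fin (k + 1), ((-1 : E) ^ (i : ℕ) * g (v i)) •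
            wedgeProd E k (fun j => v (i.succAbove j))) :
    ∀ {m : ℕ}, m ≤ n → ∀ φ : Fin m → (W →ₗ[E] E),
      ¬ Function.Surjective (LinearMap.pi φ) → iterContract c m φ n = 0
  | 0, _, _, h => (h fun y => ⟨0, Subsingleton.elim _ y⟩).elim
  | m + 1, hm, φ, h => by
    change (c (n - m) (φ (Fin.last m))).comp (iterContract c m (fun i => φ i.castSucc) n) = 0
    by_cases hs : Function.Surjective (LinearMap.pi fun i : Fin m => φ i.castSucc)
    · obtain ⟨b, hφ, hb, -⟩ := exists_adapted_spanning_family hn hs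
      have hlast (j : ℕ) (hj : m ≤ j) : φ (Fin.last m) (b j) = 0 := by
        by_contra hne
        exact h (surjective_pi_of_ne_zero hs (fun i => by rw [hφ, if_neg (by omega)]) hne)
      rw [← LinearMap.range_eq_bot, LinearMap.range_comp,
        range_iterContract_eq_span (by omega) hc hφ hb, Submodule.map_span, Set.image_singleton,
        contract_wedgeProd_tail hc (by omega) _ b m fun j hj => hlast j hj.le, hlast m le_rfl,
        zero_smul, Submodule.span_zero_singleton]
    · rw [iterContract_eq_zero_of_not_surjective hn hc (by omega) _ hs, LinearMap.comp_zero]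

end Field

/-- Let `E` be a field, `W` an `n`-dimensional `E`-vector space, `m ≤ n` and
`φ₁,…,φ_m ∈ Hom_E(W,E)`; set `Φ := ⊕ᵢ φᵢ : W → E^m`.  Writing `φ` also for the contraction
homomorphisms on exterior powers determined by each `φᵢ`, the image of the map
`⋀^n W → ⋀^{n-m} W`, `b ↦ (φ_m ∘ ⋯ ∘ φ₁)(b)`, is equal to `⋀^{n-m} ker Φ` (regarded as a
subspace of `⋀^{n-m} W` via the inclusion `ker Φ ⊆ W`) if `Φ` is surjective, and is `0`
otherwise.  Both sides are compared inside the exterior algebra of `W`. -/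
theorem range_iterContract_top_exteriorPower
    (E W : Type*) [Field E] [AddCommGroup W] [Module E W] [FiniteDimensional E W]
    (n : ℕ) (hn : Module.finrank E W = n) (m : ℕ) (hm : m ≤ n)
    (φ : Fin m → (W →ₗ[E] E))
    (c : ∀ k : ℕ, (W →ₗ[E] E) → (↥(⋀[E]^k W) →ₗ[E] ↥(⋀[E]^(k - 1) W)))
    (hc : ∀ (k : ℕ) (g : W →ₗ[E] E) (v : Fin (k + 1) → W),
        c (k + 1) g (wedgeProd E (k + 1) v) =
          ∑ i : Fin (k + 1), ((-1 : E) ^ (i : ℕ) * g (v i)) •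
            wedgeProd E k (fun j => v (i.succAbove j))) :
    (Function.Surjective (LinearMap.pi φ) →
        Submodule.map (⋀[E]^(n - m) W).subtype
            (LinearMap.range (iterContract c m φ n)) =
          Submodule.map
            (ExteriorAlgebra.map (LinearMap.ker (LinearMap.pi φ)).subtype).toLinearMap
            (⋀[E]^(n - m) ↥(LinearMap.ker (LinearMap.pi φ)))) ∧
    (¬ Function.Surjective (LinearMap.pi φ) →
        LinearMap.range (iterContract c m φ n) = ⊥) := by
  refine ⟨fun hs => ?_, fun hs => ?_⟩
  · obtain ⟨b, hφ, hb, κ, hκ, hκb⟩ := exists_adapted_spanning_family hn hs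
    rw [range_iterContract_eq_span hm hc hφ hb, ← span_ιMulti_of_span_eq_top hκ,
      Submodule.map_span, Submodule.map_span, Set.image_singleton, Set.image_singleton,
      AlgHom.toLinearMap_apply, ExteriorAlgebra.map_apply_ιMulti]
    simp [wedgeProd, Function.comp_def, hκb]
  · rw [iterContract_eq_zero_of_not_surjective hn hc hm φ hs, LinearMap.range_zero]
end

section
/- Let K be a field of characteristic zero, A a finite-dimensional simple K-algebra with center F, K' an extension field of K, and Ω an algebraic closure of K'. Then: (1) the set Σ(F/K,K') of equivalence classes of K-algebra embeddings F → Ω under the relation σ ∼ σ' ⇔ σ = τ ∘ σ' for some τ ∈ Aut_{K'}(Ω) is finite; (2) for each K-embedding σ : F → Ω, the ring A ⊗_F (σ(F)K') is a simple Artinian ring whose center is σ(F)K', and this ring is independent (up to the evident isomorphism) of the representative σ of its equivalence class; and (3) there is an isomorphism of K'-algebras A ⊗_K K' ≅ ∏_{σ} A ⊗_F (σ(F)K'), where the product runs over a set of representatives of the equivalence classes in Σ(F/K,K'). -/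
open scoped TensorProduct

namespace TensorProduct

variable {F A L : Type*} [Field F] [Ring A] [Algebra F A] [CommRing L] [Algebra F L]

theorem mem_range_includeRight_of_commute [Algebra.IsCentral F A] {z : A ⊗[F] L}
    (hz : ∀ a : A, (a ⊗ₜ[F] (1 : L)) * z = z * (a ⊗ₜ[F] (1 : L))) :
    z ∈ Set.range (Algebra.TensorProduct.includeRight : L →ₐ[F] A ⊗[F] L) := by
  have h : z ∈ Subalgebra.centralizer F
      ((Algebra.TensorProduct.includeLeft : A →ₐ[F] A ⊗[F] L).range : Set (A ⊗[F] L)) := by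
    rw [Subalgebra.mem_centralizer_iff]
    rintro _ ⟨a, rfl⟩
    exact hz a
  rw [Subalgebra.centralizer_coe_range_includeLeft_eq_center_tensorProduct] at h
  obtain ⟨w, rfl⟩ := h
  clear hz
  induction w using TensorProduct.induction_on with
  | zero => exact ⟨0, by simp⟩
  | tmul a l =>
    obtain ⟨a, ha⟩ := a
    obtain ⟨f, rfl⟩ := (Algebra.IsCentral.mem_center_iff F).1 ha
    refine ⟨f • l, ?_⟩
    simp [Algebra.algebraMap_eq_smul_one, TensorProduct.smul_tmul]
  | add x y hx hy =>
    obtain ⟨l, hl⟩ := hx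
    obtain ⟨m, hm⟩ := hy
    exact ⟨l + m, by rw [map_add, hl, hm]; exact (map_add _ x y).symm⟩

theorem range_includeRight_eq_center [Algebra.IsCentral F A] :
    Set.range (Algebra.TensorProduct.includeRight : L →ₐ[F] A ⊗[F] L) =
      (Subring.center (A ⊗[F] L) : Set (A ⊗[F] L)) := by
  ext z
  constructor
  · rintro ⟨l, rfl⟩
    refine Subring.mem_center_iff.2 fun x => ?_
    induction x using TensorProduct.induction_on with
    | zero => simp
    | tmul a m => simp [mul_comm]
    | add x y hx hy => rw [add_mul, mul_add, hx, hy]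
  · intro hz
    exact mem_range_includeRight_of_commute fun a => Subring.mem_center_iff.1 hz _

theorem equivFinsuppOfBasisRight_mul_left {ι : Type*} [DecidableEq ι] (b : Module.Basis ι F L)
    (a : A) (x : A ⊗[F] L) (i : ι) :
    equivFinsuppOfBasisRight b ((a ⊗ₜ[F] (1 : L)) * x) i
      = a * equivFinsuppOfBasisRight b x i := by
  induction x using TensorProduct.induction_on with
  | zero => simp
  | tmul c m => simp
  | add x y hx hy => simp only [mul_add, map_add, Finsupp.add_apply, hx, hy]

theorem equivFinsuppOfBasisRight_mul_right {ι : Type*} [DecidableEq ι] (b : Module.Basis ι F L)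
    (a : A) (x : A ⊗[F] L) (i : ι) :
    equivFinsuppOfBasisRight b (x * (a ⊗ₜ[F] (1 : L))) i
      = equivFinsuppOfBasisRight b x i * a := by
  induction x using TensorProduct.induction_on with
  | zero => simp
  | tmul c m => simp
  | add x y hx hy => simp only [add_mul, map_add, Finsupp.add_apply, hx, hy]

/-- A nonzero two-sided ideal of `A ⊗ L` with `A` central simple meets `1 ⊗ L` nontrivially. -/
theorem exists_includeRight_mem [Algebra.IsCentral F A] [IsSimpleRing A]
    (I : TwoSidedIdeal (A ⊗[F] L)) {x : A ⊗[F] L} (hxI : x ∈ I) (hx0 : x ≠ 0) :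
    ∃ l : L, l ≠ 0 ∧ (1 : A) ⊗ₜ[F] l ∈ I := by
  classical
  let b := Module.Basis.ofVectorSpace F L
  let e := equivFinsuppOfBasisRight (M := A) b
  induction hn : (e x).support.card using Nat.strong_induction_on generalizing x with
  | _ n ih =>
  obtain ⟨i, hi⟩ : (e x).support.Nonempty := by
    rw [Finsupp.support_nonempty_iff]
    exact e.map_ne_zero_iff.2 hx0
  let J : TwoSidedIdeal A := TwoSidedIdeal.mk'
    {a | ∃ y ∈ I, (e y).support ⊆ (e x).support ∧ e y i = a}
    ⟨0, I.zero_mem, by simp, by simp⟩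
    (by
      rintro _ _ ⟨y, hy, hys, rfl⟩ ⟨z, hz, hzs, rfl⟩
      refine ⟨y + z, I.add_mem hy hz, ?_, by simp⟩
      rw [map_add]
      exact Finsupp.support_add.trans (Finset.union_subset hys hzs))
    (by
      rintro _ ⟨y, hy, hys, rfl⟩
      exact ⟨-y, I.neg_mem hy, by simpa using hys, by simp⟩)
    (by
      rintro a _ ⟨y, hy, hys, rfl⟩
      refine ⟨_, I.mul_mem_left (a ⊗ₜ 1) y hy, fun j hj => hys ?_,
        equivFinsuppOfBasisRight_mul_left b a y i⟩
      rw [Finsupp.mem_support_iff, equivFinsuppOfBasisRight_mul_left b a y j] at hj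
      exact Finsupp.mem_support_iff.2 (right_ne_zero_of_mul hj))
    (by
      rintro _ a ⟨y, hy, hys, rfl⟩
      refine ⟨_, I.mul_mem_right y (a ⊗ₜ 1) hy, fun j hj => hys ?_,
        equivFinsuppOfBasisRight_mul_right b a y i⟩
      rw [Finsupp.mem_support_iff, equivFinsuppOfBasisRight_mul_right b a y j] at hj
      exact Finsupp.mem_support_iff.2 (left_ne_zero_of_mul hj))
  have hJ : (1 : A) ∈ J := by
    refine IsSimpleRing.one_mem_of_ne_zero_mem J (Finsupp.mem_support_iff.1 hi) ?_
    rw [TwoSidedIdeal.mem_mk']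
    exact ⟨x, hxI, subset_rfl, rfl⟩
  rw [TwoSidedIdeal.mem_mk'] at hJ
  obtain ⟨y, hyI, hys, hyi⟩ := hJ
  have hy0 : y ≠ 0 := by
    rintro rfl
    simp at hyi
  by_cases hcomm : ∀ a : A, (a ⊗ₜ[F] (1 : L)) * y = y * (a ⊗ₜ[F] (1 : L))
  · obtain ⟨l, rfl⟩ := mem_range_includeRight_of_commute hcomm
    refine ⟨l, ?_, hyI⟩
    rintro rfl
    simp at hy0
  · push Not at hcomm
    obtain ⟨a, ha⟩ := hcomm
    have key (j) : e ((a ⊗ₜ[F] (1 : L)) * y - y * (a ⊗ₜ[F] (1 : L))) j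
        = a * e y j - e y j * a := by
      rw [map_sub, Finsupp.sub_apply]
      exact congr_arg₂ _ (equivFinsuppOfBasisRight_mul_left b a y j)
        (equivFinsuppOfBasisRight_mul_right b a y j)
    refine ih _ ?_ (I.sub_mem (I.mul_mem_left _ _ hyI) (I.mul_mem_right _ _ hyI))
      (sub_ne_zero.2 ha) rfl
    rw [← hn]
    refine Finset.card_lt_card (Finset.ssubset_iff.2 ⟨i, ?_, Finset.insert_subset hi ?_⟩)
    · rw [Finsupp.mem_support_iff, key, hyi]
      simp
    · intro j hj
      refine hys (Finsupp.mem_support_iff.2 fun h => ?_)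
      rw [Finsupp.mem_support_iff, key, h] at hj
      simp at hj

theorem includeRight_injective_of_field [Nontrivial A] :
    Function.Injective (Algebra.TensorProduct.includeRight : L →ₐ[F] A ⊗[F] L) :=
  Algebra.TensorProduct.includeRight_injective (algebraMap F A).injective

theorem isSimpleRing_of_isCentral [Algebra.IsCentral F A] [IsSimpleRing A] (hL : IsField L) :
    IsSimpleRing (A ⊗[F] L) := by
  have : Nontrivial L := hL.nontrivial
  have : Nontrivial (A ⊗[F] L) := includeRight_injective_of_field.nontrivial
  refine IsSimpleRing.of_eq_bot_or_eq_top fun I => or_iff_not_imp_left.2 fun hI => ?_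
  obtain ⟨x, hxI, hx0⟩ : ∃ x ∈ I, x ≠ 0 := by
    by_contra! h
    exact hI (eq_bot_iff.2 fun x hx => (TwoSidedIdeal.mem_bot _).2 (h x hx))
  obtain ⟨l, hl, hlI⟩ := exists_includeRight_mem I hxI hx0
  obtain ⟨m, hm⟩ := hL.mul_inv_cancel hl
  refine (TwoSidedIdeal.one_mem_iff _).1 ?_
  have := I.mul_mem_right _ ((1 : A) ⊗ₜ[F] m) hlI
  rwa [Algebra.TensorProduct.tmul_mul_tmul, hm, one_mul, ← Algebra.TensorProduct.one_def] at this

theorem isArtinianRing_of_finite [Module.Finite F A] [IsArtinianRing L] :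
    IsArtinianRing (A ⊗[F] L) :=
  have : IsArtinianRing (L ⊗[F] A) := .of_finite L _
  (Algebra.TensorProduct.comm F L A).toRingEquiv.isArtinianRing

end TensorProduct

section

variable {k R Ω : Type*} [Field k] [CommRing R] [Algebra k R] [Field Ω] [Algebra k Ω]

theorem AlgHom.isField_range_of_isAlgebraic [Algebra.IsAlgebraic k R] (g : R →ₐ[k] Ω) :
    IsField g.range := by
  have : Algebra.IsIntegral k g.range :=
    .of_surjective g.rangeRestrict g.rangeRestrict_surjective
  exact isField_of_isIntegral_of_isField' (Field.toIsField k)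

/-- Two points with values in an algebraic closure that have the same kernel are conjugate. -/
theorem AlgHom.exists_algEquiv_of_ker_eq [IsAlgClosure k Ω] [Algebra.IsAlgebraic k R]
    {g h : R →ₐ[k] Ω} (hgh : RingHom.ker g = RingHom.ker h) :
    ∃ τ : Ω ≃ₐ[k] Ω, ∀ x, g x = τ (h x) := by
  have closure (f : R →ₐ[k] Ω) : IsAlgClosure f.range Ω :=
    { isAlgClosed := IsAlgClosure.isAlgClosed k
      isAlgebraic := Algebra.IsAlgebraic.extendScalars (algebraMap k f.range).injective }
  have := closure g
  have := closure h
  let E : h.range ≃+* g.range :=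
    ((Ideal.quotientKerEquivRange h).symm.toRingEquiv.trans
      (Ideal.quotEquivOfEq hgh.symm)).trans (Ideal.quotientKerEquivRange g).toRingEquiv
  have hE (x : R) : E (h.rangeRestrict x) = g.rangeRestrict x := by
    have : (Ideal.quotientKerEquivRange h).symm (h.rangeRestrict x)
        = Ideal.Quotient.mk (RingHom.ker h) x :=
      (AlgEquiv.symm_apply_eq _).2 rfl
    change (Ideal.quotientKerEquivRange g) (Ideal.quotEquivOfEq hgh.symm
      ((Ideal.quotientKerEquivRange h).symm (h.rangeRestrict x))) = _
    rw [this]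
    rfl
  let τ : Ω ≃+* Ω := IsAlgClosure.equivOfEquiv Ω Ω E
  have hτ (x : R) : τ (h x) = g x := by
    have := IsAlgClosure.equivOfEquiv_algebraMap Ω Ω E (h.rangeRestrict x)
    rw [hE] at this
    exact this
  exact ⟨AlgEquiv.ofRingEquiv (f := τ) fun c => by simpa using hτ (algebraMap k R c),
    fun x => (hτ x).symm⟩

variable {ι : Type*} (g : ι → R →ₐ[k] Ω)

theorem AlgHom.exists_forall_eq_of_ker_injective [_root_.Finite ι] [Algebra.IsAlgebraic k R]
    (hg : Function.Injective fun i => RingHom.ker (g i)) (y : ι → R) :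
    ∃ r, ∀ i, g i r = g i (y i) := by
  have hmax (i) : (RingHom.ker (g i)).IsMaximal := by
    refine Ideal.Quotient.maximal_of_isField _ ?_
    exact (Ideal.quotientKerEquivRange (g i)).toMulEquiv.isField
      (g i).isField_range_of_isAlgebraic
  obtain ⟨r, hr⟩ := Ideal.pi_quotient_surjective (I := fun i => RingHom.ker (g i))
    (fun i j hij => Ideal.isCoprime_of_isMaximal (fun h => hij (hg h)))
    (fun i => Ideal.Quotient.mk _ (y i))
  refine ⟨r, fun i => ?_⟩
  have := (Ideal.Quotient.mk_eq_mk_iff_sub_mem _ _).1 (hr i)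
  rwa [RingHom.mem_ker, map_sub, sub_eq_zero] at this

theorem eq_zero_of_forall_algHom_eq_zero [IsAlgClosed Ω] [Module.Finite k R] [IsReduced R] {x : R}
    (hx : ∀ h : R →ₐ[k] Ω, h x = 0) : x = 0 := by
  have : IsArtinianRing R := .of_finite k R
  rw [← Ideal.mem_bot, ← Ideal.zero_eq_bot, ← nilradical_eq_zero R, nilradical_eq_sInf,
    Ideal.mem_sInf]
  intro p hp
  have hp : p.IsPrime := hp
  have := IsArtinianRing.isMaximal_of_isPrime p
  let := Ideal.Quotient.field p
  let h : (R ⧸ p) →ₐ[k] Ω := IsAlgClosed.lift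
  have := hx (h.comp (Ideal.Quotient.mkₐ k p))
  exact Ideal.Quotient.eq_zero_iff_mem.1 (h.injective (this.trans (map_zero h).symm))

end

section

variable (K : Type*) [Field K]
variable (A : Type*) [Ring A] [Algebra K A] [FiniteDimensional K A] [IsSimpleRing A]
variable (F : Type*) [Field F] [Algebra K F] [Algebra F A] [IsScalarTower K F A]
variable (K' : Type*) [Field K'] [Algebra K K']
variable (Ω : Type*) [Field Ω] [Algebra K' Ω] [IsAlgClosure K' Ω] [Algebra K Ω]
  [IsScalarTower K K' Ω]

/-- The compositum `σ(F)K'` of `σ(F)` and `K'` inside `Ω`, i.e. the `K'`-subalgebra of `Ω`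
generated by the image of the `K`-embedding `σ : F → Ω`. -/
noncomputable def compositum (σ : F →ₐ[K] Ω) : Subalgebra K' Ω :=
  Algebra.adjoin K' (Set.range ⇑σ)

/-- The compositum `σ(F)K'` is regarded as an `F`-algebra via `σ`. -/
noncomputable instance compositumAlgebra (σ : F →ₐ[K] Ω) :
    Algebra F ↥(compositum K F K' Ω σ) :=
  (RingHom.codRestrict σ.toRingHom (compositum K F K' Ω σ)
    (fun x => Algebra.subset_adjoin (Set.mem_range_self x))).toAlgebra

end

section compositum

variable {K F K' Ω : Type*} [Field K] [Field F] [Algebra K F] [Field K'] [Field Ω]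
  [Algebra K' Ω] [Algebra K Ω]

@[simp]
theorem coe_algebraMap_compositum (σ : F →ₐ[K] Ω) (x : F) :
    (algebraMap F (compositum K F K' Ω σ) x : Ω) = σ x :=
  rfl

variable (K F K' Ω) in
/-- Embeddings `F → Ω` are equivalent when they differ by a `K'`-automorphism of `Ω`. -/
def embeddingSetoid : Setoid (F →ₐ[K] Ω) where
  r σ σ' := ∃ τ : Ω ≃ₐ[K'] Ω, ∀ x : F, σ x = τ (σ' x)
  iseqv :=
    { refl := fun σ => ⟨.refl, fun _ => rfl⟩
      symm := fun ⟨τ, h⟩ => ⟨τ.symm, fun x => by rw [h, AlgEquiv.symm_apply_apply]⟩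
      trans := fun ⟨τ, h⟩ ⟨τ', h'⟩ => ⟨τ'.trans τ, fun x => by rw [h, h']; rfl⟩ }

theorem exists_finset_embedding_representatives [FiniteDimensional K F] :
    ∃ S : Finset (F →ₐ[K] Ω), ∀ σ : F →ₐ[K] Ω, ∃! σ' : F →ₐ[K] Ω, σ' ∈ S ∧
      ∃ τ : Ω ≃ₐ[K'] Ω, ∀ x : F, σ x = τ (σ' x) := by
  classical
  let s := embeddingSetoid K F K' Ω
  have : Fintype (F →ₐ[K] Ω) := Fintype.ofFinite _
  refine ⟨Finset.univ.image fun σ : F →ₐ[K] Ω => (Quotient.mk s σ).out, fun σ =>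
    ⟨(Quotient.mk s σ).out, ⟨Finset.mem_image_of_mem _ (Finset.mem_univ σ),
      s.symm (Quotient.mk_out σ)⟩, ?_⟩⟩
  rintro ρ ⟨hρ, h⟩
  obtain ⟨π, -, rfl⟩ := Finset.mem_image.1 hρ
  have : Quotient.mk s σ = Quotient.mk s π := (Quotient.sound h).trans (Quotient.out_eq _)
  rw [this]

variable [Algebra K K'] [IsScalarTower K K' Ω]

instance isScalarTower_compositum (σ : F →ₐ[K] Ω) :
    IsScalarTower K F (compositum K F K' Ω σ) :=
  .of_algebraMap_eq fun x => Subtype.ext <| by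
    rw [coe_algebraMap_compositum, AlgHom.commutes]
    rfl

/-- The `K'`-algebra map `K' ⊗ F → Ω` given by `c ⊗ x ↦ c σ(x)`. -/
noncomputable def compositumMap (K' : Type*) [Field K'] [Algebra K K'] [Algebra K' Ω]
    [IsScalarTower K K' Ω] (σ : F →ₐ[K] Ω) : K' ⊗[K] F →ₐ[K'] Ω :=
  Algebra.TensorProduct.lift (Algebra.ofId K' Ω) σ fun _ _ => Commute.all _ _

@[simp]
theorem compositumMap_tmul (σ : F →ₐ[K] Ω) (c : K') (x : F) :
    compositumMap K' σ (c ⊗ₜ x) = algebraMap K' Ω c * σ x :=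
  rfl

theorem range_compositumMap (σ : F →ₐ[K] Ω) :
    (compositumMap K' σ).range = compositum K F K' Ω σ := by
  apply le_antisymm
  · rintro _ ⟨x, rfl⟩
    change compositumMap K' σ x ∈ _
    induction x using TensorProduct.induction_on with
    | zero => simp
    | tmul c x =>
      exact mul_mem (Subalgebra.algebraMap_mem _ c) (Algebra.subset_adjoin (Set.mem_range_self x))
    | add x y hx hy => exact map_add (compositumMap K' σ) x y ▸ add_mem hx hy
  · refine Algebra.adjoin_le ?_
    rintro _ ⟨x, rfl⟩
    exact ⟨1 ⊗ₜ x, by simp⟩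

theorem isField_compositum [FiniteDimensional K F] (σ : F →ₐ[K] Ω) :
    IsField (compositum K F K' Ω σ) :=
  range_compositumMap (K' := K') σ ▸ (compositumMap K' σ).isField_range_of_isAlgebraic

/-- The composita of conjugate embeddings are isomorphic as `F`-algebras. -/
noncomputable def compositumCongr {σ σ' : F →ₐ[K] Ω} (τ : Ω ≃ₐ[K'] Ω)
    (h : ∀ x, σ x = τ (σ' x)) : compositum K F K' Ω σ' ≃ₐ[F] compositum K F K' Ω σ :=
  have hmap : (compositum K F K' Ω σ').map (τ : Ω →ₐ[K'] Ω) = compositum K F K' Ω σ := by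
    rw [compositum, AlgHom.map_adjoin, compositum, ← Set.range_comp]
    congr 2
    exact funext fun x => (h x).symm
  AlgEquiv.ofRingEquiv
    (f := RingEquiv.trans
      ((compositum K F K' Ω σ').equivMapOfInjective (τ : Ω →ₐ[K'] Ω) τ.injective).toRingEquiv
      (Subalgebra.equivOfEq _ _ hmap).toRingEquiv)
    fun x => Subtype.ext (h x).symm

variable (K') in
/-- The `F`-algebra map `F ⊗ K' → σ(F)K'` given by `x ⊗ c ↦ σ(x) c`. -/
noncomputable def toCompositum (σ : F →ₐ[K] Ω) : F ⊗[K] K' →ₐ[F] compositum K F K' Ω σ :=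
  Algebra.TensorProduct.lift (Algebra.ofId F _)
    ((Algebra.ofId K' (compositum K F K' Ω σ)).restrictScalars K) fun _ _ => Commute.all _ _

theorem toCompositum_tmul (σ : F →ₐ[K] Ω) (x : F) (c : K') :
    toCompositum K' σ (x ⊗ₜ c) = algebraMap F _ x * algebraMap K' _ c :=
  rfl

theorem coe_toCompositum (σ : F →ₐ[K] Ω) (x : F ⊗[K] K') :
    (toCompositum K' σ x : Ω) = compositumMap K' σ (Algebra.TensorProduct.comm K F K' x) := by
  induction x using TensorProduct.induction_on with
  | zero => simp
  | tmul x c => exact mul_comm _ _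
  | add x y hx hy => simp only [map_add, ← hx, ← hy]; rfl

theorem bijective_pi_toCompositum [IsAlgClosure K' Ω] [FiniteDimensional K F]
    [Algebra.IsSeparable K F]
    {S : Finset (F →ₐ[K] Ω)}
    (hS : ∀ σ : F →ₐ[K] Ω, ∃! σ' : F →ₐ[K] Ω, σ' ∈ S ∧
      ∃ τ : Ω ≃ₐ[K'] Ω, ∀ x : F, σ x = τ (σ' x)) :
    Function.Bijective (AlgHom.pi (R := F) (A := fun σ : S => compositum K F K' Ω (σ : F →ₐ[K] Ω))
      fun σ => toCompositum K' (σ : F →ₐ[K] Ω)) := by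
  have : IsAlgClosed Ω := IsAlgClosure.isAlgClosed K'
  have : Algebra.FormallyUnramified K F := .of_isSeparable K F
  have : IsReduced (K' ⊗[K] F) := Algebra.FormallyUnramified.isReduced_of_field K' _
  let c := Algebra.TensorProduct.comm K F K'
  constructor
  · refine (injective_iff_map_eq_zero _).2 fun x hx => ?_
    refine c.map_eq_zero_iff.1 (eq_zero_of_forall_algHom_eq_zero (k := K') (Ω := Ω) fun h => ?_)
    let σ : F →ₐ[K] Ω := (h.restrictScalars K).comp Algebra.TensorProduct.includeRight
    obtain ⟨σ', ⟨hσ', τ, hτ⟩, -⟩ := hS σ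
    have hh : h = (τ : Ω →ₐ[K'] Ω).comp (compositumMap K' σ') := by
      refine Algebra.TensorProduct.ext (by ext) ?_
      ext x
      change σ x = _
      simpa using hτ x
    have hx' : compositumMap K' σ' (c x) = 0 := by
      rw [← coe_toCompositum]
      exact congr_arg Subtype.val (congr_fun hx ⟨σ', hσ'⟩)
    rw [hh, AlgHom.comp_apply]
    exact (congr_arg τ hx').trans (map_zero τ)
  · intro y
    have hy (σ : S) : ∃ z, compositumMap K' (σ : F →ₐ[K] Ω) z = y σ :=
      (range_compositumMap (K' := K') (σ : F →ₐ[K] Ω)).ge (y σ).2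
    choose z hz using hy
    have hinj : Function.Injective fun σ : S =>
        RingHom.ker (compositumMap K' (σ : F →ₐ[K] Ω)) := by
      refine fun σ ρ hσρ => Subtype.ext ?_
      obtain ⟨τ, hτ⟩ := AlgHom.exists_algEquiv_of_ker_eq hσρ
      refine (hS σ).unique ⟨σ.2, .refl, fun _ => rfl⟩ ⟨ρ.2, τ, fun x => ?_⟩
      simpa using hτ (1 ⊗ₜ x)
    obtain ⟨r, hr⟩ := AlgHom.exists_forall_eq_of_ker_injective
      (fun σ : S => compositumMap K' (σ : F →ₐ[K] Ω)) hinj z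
    refine ⟨c.symm r, funext fun σ => Subtype.ext ?_⟩
    change (toCompositum K' (σ : F →ₐ[K] Ω) (c.symm r) : Ω) = _
    rw [coe_toCompositum, AlgEquiv.apply_symm_apply, hr, hz]

end compositum

/-- If `F ⊗ K'` is a finite product of rings `L i`, then `K' ⊗ A` is the product of the
rings `A ⊗ L i`, for every `F`-algebra `A`. -/
theorem exists_ringEquiv_pi_tensorProduct {K F A K' ι : Type*} [Field K] [Field F] [Algebra K F]
    [Ring A] [Algebra K A] [Algebra F A] [IsScalarTower K F A] [Field K'] [Algebra K K']
    [Finite ι] {L : ι → Type*} [∀ i, CommRing (L i)] [∀ i, Algebra F (L i)]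
    (ψ : F ⊗[K] K' ≃ₐ[F] ∀ i, L i) :
    ∃ e : (K' ⊗[K] A) ≃+* (∀ i, A ⊗[F] L i),
      ∀ (c : K') (a : A), e (c ⊗ₜ a) = fun i => a ⊗ₜ ψ (1 ⊗ₜ c) i := by
  classical
  have := Fintype.ofFinite ι
  let E : (K' ⊗[K] A) ≃+ (∀ i, A ⊗[F] L i) :=
    (TensorProduct.comm K K' A).toAddEquiv.trans <|
      (TensorProduct.AlgebraTensorModule.cancelBaseChange K F F A K').symm.toAddEquiv.trans <|
        (TensorProduct.congr (.refl F A) ψ.toLinearEquiv).toAddEquiv.trans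
          (TensorProduct.piRight F F A L).toAddEquiv
  have hE (c : K') (a : A) : E (c ⊗ₜ a) = fun i => a ⊗ₜ ψ (1 ⊗ₜ c) i := rfl
  refine ⟨{ E with map_mul' := fun x y => ?_ }, hE⟩
  change E (x * y) = E x * E y
  induction x using TensorProduct.induction_on with
  | zero => simp
  | add x x' hx hx' => rw [add_mul, map_add, hx, hx', map_add, add_mul]
  | tmul c a =>
    induction y using TensorProduct.induction_on with
    | zero => simp
    | add y y' hy hy' => rw [mul_add, map_add, hy, hy', map_add, mul_add]
    | tmul d b =>
      have : (1 : F) ⊗ₜ[K] (c * d) = (1 ⊗ₜ c) * (1 ⊗ₜ d) := by simp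
      rw [Algebra.TensorProduct.tmul_mul_tmul, hE, hE, hE, this, map_mul]
      ext i
      simp

section

variable (K : Type*) [Field K]
variable (A : Type*) [Ring A] [Algebra K A] [FiniteDimensional K A] [IsSimpleRing A]
variable (F : Type*) [Field F] [Algebra K F] [Algebra F A] [IsScalarTower K F A]
variable (K' : Type*) [Field K'] [Algebra K K']
variable (Ω : Type*) [Field Ω] [Algebra K' Ω] [IsAlgClosure K' Ω] [Algebra K Ω]
  [IsScalarTower K K' Ω]

set_option maxHeartbeats 1000000 in
/-- Let `K` be a field of characteristic zero, `A` a finite-dimensional simple `K`-algebra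
with centre `F`, `K'` an extension field of `K` and `Ω` an algebraic closure of `K'`.  Then:
(1) there are finitely many equivalence classes of `K`-embeddings `σ : F → Ω` under the
relation `σ ∼ σ' ⇔ σ = τ ∘ σ'` for some `τ ∈ Aut_{K'}(Ω)`;
(2) for each `K`-embedding `σ : F → Ω` the ring `A ⊗_F σ(F)K'` is a simple Artinian ring
whose centre is `σ(F)K'` (i.e. the canonical map `σ(F)K' → A ⊗_F σ(F)K'` is injective with
image the centre), and up to isomorphism this ring only depends on the equivalence class
of `σ`; and
(3) there is an isomorphism of `K'`-algebras `A ⊗_K K' ≅ ∏_σ A ⊗_F σ(F)K'`, the product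
running over a set `S` of representatives of the equivalence classes (expressed below as a
ring isomorphism from `K' ⊗_K A` which carries `c ⊗ 1` to the image of `c ∈ K'` in each
factor). -/
theorem baseChange_simple_decomposition [CharZero K]
    (hF : Set.range (algebraMap F A) = (Subalgebra.center K A : Set A)) :
    (∀ σ : F →ₐ[K] Ω,
        IsSimpleRing (A ⊗[F] ↥(compositum K F K' Ω σ)) ∧
        IsArtinianRing (A ⊗[F] ↥(compositum K F K' Ω σ)) ∧
        Function.Injective
          (Algebra.TensorProduct.includeRight :
            ↥(compositum K F K' Ω σ) →ₐ[F] A ⊗[F] ↥(compositum K F K' Ω σ)) ∧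
        Set.range
            (Algebra.TensorProduct.includeRight :
              ↥(compositum K F K' Ω σ) →ₐ[F] A ⊗[F] ↥(compositum K F K' Ω σ)) =
          (Subring.center (A ⊗[F] ↥(compositum K F K' Ω σ)) : Set _)) ∧
    (∀ σ σ' : F →ₐ[K] Ω, (∃ τ : Ω ≃ₐ[K'] Ω, ∀ x : F, σ x = τ (σ' x)) →
        Nonempty ((A ⊗[F] ↥(compositum K F K' Ω σ)) ≃+*
          (A ⊗[F] ↥(compositum K F K' Ω σ')))) ∧
    ∃ S : Finset (F →ₐ[K] Ω),
      (∀ σ : F →ₐ[K] Ω, ∃! σ' : F →ₐ[K] Ω, σ' ∈ S ∧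
          ∃ τ : Ω ≃ₐ[K'] Ω, ∀ x : F, σ x = τ (σ' x)) ∧
      ∃ e : (K' ⊗[K] A) ≃+* ((σ : S) → A ⊗[F] ↥(compositum K F K' Ω (σ : F →ₐ[K] Ω))),
        ∀ c : K', e (c ⊗ₜ[K] (1 : A)) =
          fun σ : S => (1 : A) ⊗ₜ[F]
            (algebraMap K' ↥(compositum K F K' Ω (σ : F →ₐ[K] Ω)) c) := by
  have hcentral : Algebra.IsCentral F A := ⟨fun z hz => by
    have : z ∈ Set.range (algebraMap F A) := by
      rw [hF]
      exact Subalgebra.mem_center_iff.2 (Subalgebra.mem_center_iff.1 hz)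
    obtain ⟨x, rfl⟩ := this
    exact ⟨x, rfl⟩⟩
  have : FiniteDimensional K F :=
    FiniteDimensional.of_injective (IsScalarTower.toAlgHom K F A).toLinearMap
      (algebraMap F A).injective
  have : Module.Finite F A := Module.Finite.of_restrictScalars_finite K F A
  refine ⟨fun σ => ?_, fun σ σ' ⟨τ, hτ⟩ => ?_, ?_⟩
  · have hL : IsField (compositum K F K' Ω σ) := isField_compositum σ
    have : Nontrivial (compositum K F K' Ω σ) := hL.nontrivial
    have : IsArtinianRing (compositum K F K' Ω σ) :=
      letI := hL.toField
      inferInstance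
    exact ⟨TensorProduct.isSimpleRing_of_isCentral hL, TensorProduct.isArtinianRing_of_finite,
      TensorProduct.includeRight_injective_of_field,
      TensorProduct.range_includeRight_eq_center⟩
  · exact ⟨(Algebra.TensorProduct.congr (.refl : A ≃ₐ[F] A)
      (compositumCongr τ hτ).symm).toRingEquiv⟩
  · obtain ⟨S, hS⟩ := exists_finset_embedding_representatives (K := K) (F := F) (K' := K') (Ω := Ω)
    obtain ⟨e, he⟩ := exists_ringEquiv_pi_tensorProduct (A := A)
      (AlgEquiv.ofBijective _ (bijective_pi_toCompositum hS))
    refine ⟨S, hS, e, fun c => ?_⟩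
    rw [he]
    funext σ
    change 1 ⊗ₜ[F] toCompositum K' (σ : F →ₐ[K] Ω) (1 ⊗ₜ c) = _
    rw [toCompositum_tmul, map_one, one_mul]

end
end

section
/- Let K be a field, F a finite separable extension of K, K' an extension field of K, and Ω an algebraic closure of K'. Then there is an isomorphism of K'-algebras F ⊗_K K' ≅ ∏_{σ} σ(F)K', where the product runs over a set of representatives σ of the equivalence classes of K-algebra embeddings F → Ω under the relation σ ∼ σ' ⇔ σ = τ ∘ σ' for some τ ∈ Aut_{K'}(Ω), each compositum σ(F)K' is regarded as an F-algebra via σ and as a K'-algebra via the inclusion, and the set of such equivalence classes is finite. -/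
open scoped TensorProduct

/-- Two homomorphisms from an algebra into an algebraic closure of the base field which have the
same kernel are conjugate under an automorphism of the algebraic closure. -/
theorem IsAlgClosure.exists_algEquiv_apply_eq_of_ker_eq {L A Ω : Type*} [Field L] [CommRing A]
    [Algebra L A] [Field Ω] [Algebra L Ω] [IsAlgClosure L Ω] (φ ψ : A →ₐ[L] Ω)
    (h : RingHom.ker φ = RingHom.ker ψ) : ∃ τ : Ω ≃ₐ[L] Ω, ∀ a, φ a = τ (ψ a) := by
  have : Algebra.IsAlgebraic L Ω := IsAlgClosure.isAlgebraic
  have : IsAlgClosed Ω := IsAlgClosure.isAlgClosed L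
  let E : IntermediateField L Ω := ψ.range.toIntermediateField' ψ.range.isField_of_algebraic
  let ψ' : A →ₐ[L] E := ψ.codRestrict E.toSubalgebra fun a ↦ ⟨a, rfl⟩
  have hψ' : Function.Surjective ψ' := by
    rintro ⟨_, a, rfl⟩
    exact ⟨a, rfl⟩
  have hker : ∀ a, a ∈ RingHom.ker ψ' → φ a = 0 := fun a ha ↦ by
    have : a ∈ RingHom.ker ψ := congrArg Subtype.val (RingHom.mem_ker.mp ha)
    rwa [← h, RingHom.mem_ker] at this
  let f : E →ₐ[L] Ω := (Ideal.Quotient.liftₐ (RingHom.ker ψ') φ hker).comp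
    (Ideal.quotientKerAlgEquivOfSurjective hψ').symm.toAlgHom
  have hf (a : A) : f (ψ' a) = φ a := by
    have : (Ideal.quotientKerAlgEquivOfSurjective hψ').symm (ψ' a) =
        Ideal.Quotient.mk (RingHom.ker ψ') a := by
      rw [AlgEquiv.symm_apply_eq]
      rfl
    change Ideal.Quotient.liftₐ (RingHom.ker ψ') φ hker
      ((Ideal.quotientKerAlgEquivOfSurjective hψ').symm (ψ' a)) = φ a
    rw [this]
    rfl
  obtain ⟨g, hg⟩ := IntermediateField.exists_algHom_of_splits
    (fun s : Ω ↦ ⟨Algebra.IsIntegral.isIntegral (R := L) s, IsAlgClosed.splits _⟩) f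
  refine ⟨AlgEquiv.ofBijective g (Algebra.IsAlgebraic.algHom_bijective g), fun a ↦ ?_⟩
  rw [← hf a, ← hg]
  rfl

/-- For an extension field `Ω` of a field `L`, a finite reduced `L`-algebra `A` is the product of
the images of any family of homomorphisms `A → Ω` in which each maximal ideal of `A` occurs exactly
once as a kernel. -/
theorem bijective_algHomPi_rangeRestrict {L A Ω ι : Type*} [Field L] [CommRing A] [Algebra L A]
    [Module.Finite L A] [IsReduced A] [Field Ω] [Algebra L Ω] [Finite ι]
    (φ : ι → A →ₐ[L] Ω) (hinj : Function.Injective fun i ↦ RingHom.ker (φ i))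
    (hsurj : ∀ m : Ideal A, m.IsMaximal → ∃ i, RingHom.ker (φ i) = m) :
    Function.Bijective (AlgHom.pi fun i ↦ (φ i).rangeRestrict) := by
  have : IsArtinianRing A := IsArtinianRing.of_finite L A
  constructor
  · rw [injective_iff_map_eq_zero]
    intro a ha
    have hmem : a ∈ Ring.jacobson A := by
      rw [Ring.jacobson_eq_sInf_isMaximal, Submodule.mem_sInf]
      intro m hm
      obtain ⟨i, rfl⟩ := hsurj m hm
      exact congrArg Subtype.val (congrFun ha i)
    rw [Ring.jacobson_eq_nilradical_of_krullDimLE_zero, nilradical_eq_zero] at hmem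
    exact hmem
  · intro y
    choose b hb using fun i ↦ (φ i).rangeRestrict_surjective (y i)
    have hcop : Pairwise fun i j ↦ IsCoprime (RingHom.ker (φ i)) (RingHom.ker (φ j)) := by
      intro i j hij
      have (k : ι) : (RingHom.ker (φ k)).IsMaximal :=
        have := RingHom.ker_isPrime (φ k)
        IsArtinianRing.isMaximal_of_isPrime _
      exact Ideal.isCoprime_of_isMaximal (hinj.ne hij)
    obtain ⟨a, ha⟩ := Ideal.pi_quotient_surjective hcop fun i ↦ Ideal.Quotient.mk _ (b i)
    refine ⟨a, funext fun i ↦ ?_⟩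
    rw [← hb i]
    refine Subtype.ext ?_
    have := Ideal.Quotient.eq.mp (ha i)
    rwa [RingHom.mem_ker, map_sub, sub_eq_zero] at this

/-- Let `F/K` be a finite separable extension of fields, `K'` an extension field of `K`
and `Ω` an algebraic closure of `K'`.  Then there are finitely many equivalence classes of
`K`-algebra embeddings `σ : F → Ω` under the relation `σ ∼ σ' ⇔ σ = τ ∘ σ'` for some
`τ ∈ Aut_{K'}(Ω)`, and for any set `S` of representatives of these classes there is an
isomorphism of `K'`-algebras `F ⊗_K K' ≅ ∏_{σ ∈ S} σ(F)K'`, where `σ(F)K'` denotes the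
compositum of `σ(F)` and `K'` inside `Ω` (the `K'`-subalgebra of `Ω` generated by `σ(F)`). -/
theorem finite_separable_baseChange_iso_prod_composita
    (K F K' Ω : Type*) [Field K] [Field F] [Algebra K F] [FiniteDimensional K F]
    [Algebra.IsSeparable K F] [Field K'] [Algebra K K'] [Field Ω] [Algebra K' Ω]
    [IsAlgClosure K' Ω] [Algebra K Ω] [IsScalarTower K K' Ω] :
    ∃ S : Finset (F →ₐ[K] Ω),
      (∀ σ : F →ₐ[K] Ω, ∃! σ' : F →ₐ[K] Ω, σ' ∈ S ∧
          ∃ τ : Ω ≃ₐ[K'] Ω, ∀ x : F, σ x = τ (σ' x)) ∧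
      Nonempty ((K' ⊗[K] F) ≃ₐ[K']
        ((σ : S) → ↥(Algebra.adjoin K' (Set.range ⇑(σ : F →ₐ[K] Ω))))) := by
  classical
  have : Algebra.IsAlgebraic K' Ω := IsAlgClosure.isAlgebraic
  have : IsAlgClosed Ω := IsAlgClosure.isAlgClosed K'
  have : Algebra.FormallyUnramified K F := Algebra.FormallyUnramified.of_isSeparable K F
  have : IsReduced (K' ⊗[K] F) := Algebra.FormallyUnramified.isReduced_of_field K' (K' ⊗[K] F)
  have : IsArtinianRing (K' ⊗[K] F) := IsArtinianRing.of_finite K' _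
  let Φ (σ : F →ₐ[K] Ω) : K' ⊗[K] F →ₐ[K'] Ω :=
    Algebra.TensorProduct.lift (Algebra.ofId K' Ω) σ fun _ _ ↦ Commute.all _ _
  have hΦ (σ : F →ₐ[K] Ω) (x : F) : Φ σ (1 ⊗ₜ x) = σ x := by simp [Φ]
  have hΦ_comp (σ σ' : F →ₐ[K] Ω) (τ : Ω ≃ₐ[K'] Ω) (h : ∀ x, σ x = τ (σ' x)) :
      Φ σ = τ.toAlgHom.comp (Φ σ') := by
    ext x
    simp [hΦ, h]
  have hker (σ σ' : F →ₐ[K] Ω) :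
      RingHom.ker (Φ σ) = RingHom.ker (Φ σ') ↔ ∃ τ : Ω ≃ₐ[K'] Ω, ∀ x : F, σ x = τ (σ' x) := by
    constructor
    · intro h
      obtain ⟨τ, hτ⟩ := IsAlgClosure.exists_algEquiv_apply_eq_of_ker_eq _ _ h
      exact ⟨τ, fun x ↦ by rw [← hΦ, ← hΦ, hτ]⟩
    · rintro ⟨τ, hτ⟩
      ext a
      simp [hΦ_comp σ σ' τ hτ]
  have hrange (σ : F →ₐ[K] Ω) : (Φ σ).range = Algebra.adjoin K' (Set.range σ) := by
    apply le_antisymm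
    · rintro _ ⟨a, rfl⟩
      induction a using TensorProduct.induction_on with
      | zero => simp
      | add a b ha hb => simpa using add_mem ha hb
      | tmul r x =>
        have : Φ σ (r ⊗ₜ x) = r • σ x := by simp [Φ, Algebra.ofId_apply, Algebra.smul_def]
        exact this ▸ Subalgebra.smul_mem _ (Algebra.subset_adjoin (Set.mem_range_self x)) r
    · rw [Algebra.adjoin_le_iff]
      rintro _ ⟨x, rfl⟩
      exact ⟨1 ⊗ₜ x, hΦ σ x⟩
  have hmax (m : Ideal (K' ⊗[K] F)) (hm : m.IsMaximal) : ∃ σ, RingHom.ker (Φ σ) = m := by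
    let := Ideal.Quotient.field m
    let f : K' ⊗[K] F →ₐ[K'] Ω :=
      (IsAlgClosed.lift : (K' ⊗[K] F) ⧸ m →ₐ[K'] Ω).comp (Ideal.Quotient.mkₐ K' m)
    refine ⟨(f.restrictScalars K).comp Algebra.TensorProduct.includeRight, ?_⟩
    have hf : Φ ((f.restrictScalars K).comp Algebra.TensorProduct.includeRight) = f := by
      ext x
      simp [hΦ]
    rw [hf]
    ext a
    simp [f, RingHom.mem_ker, Ideal.Quotient.eq_zero_iff_mem]
  let s : Setoid (F →ₐ[K] Ω) := Setoid.ker fun σ ↦ RingHom.ker (Φ σ)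
  have hout (σ : F →ₐ[K] Ω) :
      RingHom.ker (Φ (Quotient.mk s σ).out) = RingHom.ker (Φ σ) := Quotient.mk_out (s := s) σ
  let S : Finset (F →ₐ[K] Ω) := Finset.univ.image fun q : Quotient s ↦ q.out
  have hS_mem (σ : F →ₐ[K] Ω) : (Quotient.mk s σ).out ∈ S :=
    Finset.mem_image_of_mem _ (Finset.mem_univ _)
  have hS_inj {σ σ' : F →ₐ[K] Ω} (hσ : σ ∈ S) (hσ' : σ' ∈ S)
      (h : RingHom.ker (Φ σ) = RingHom.ker (Φ σ')) : σ = σ' := by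
    obtain ⟨q, -, rfl⟩ := Finset.mem_image.mp hσ
    obtain ⟨q', -, rfl⟩ := Finset.mem_image.mp hσ'
    exact congrArg Quotient.out (Quotient.out_equiv_out.mp h)
  refine ⟨S, fun σ ↦ ⟨(Quotient.mk s σ).out, ⟨hS_mem σ, (hker _ _).mp (hout σ).symm⟩, ?_⟩, ?_⟩
  · rintro σ' ⟨hσ', h⟩
    exact hS_inj hσ' (hS_mem σ) (((hker _ _).mpr h).symm.trans (hout σ).symm)
  · have hbij := bijective_algHomPi_rangeRestrict (fun σ : S ↦ Φ σ)
      (fun σ σ' h ↦ Subtype.ext (hS_inj σ.2 σ'.2 h)) fun m hm ↦ by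
        obtain ⟨σ, rfl⟩ := hmax m hm
        exact ⟨⟨_, hS_mem σ⟩, hout σ⟩
    exact ⟨(AlgEquiv.ofBijective _ hbij).trans
      (AlgEquiv.piCongrRight fun σ ↦ Subalgebra.equivOfEq _ _ (hrange σ))⟩
end

section
/- Let Λ be a ring and suppose given a commutative diagram of finitely generated projective left Λ-modules with rows M_1 →^{d_1'} N_1 →^{d_1} P_1, M_2 →^{d_2'} N_2 →^{d_2} P_2, M_3 →^{d_3'} N_3 →^{d_3} P_3 and columns given by maps ε_1 : M_1 → M_2, ε_2 : M_2 → M_3, φ_1 : N_1 → N_2, φ_2 : N_2 → N_3, κ_1 : P_1 → P_2, κ_2 : P_2 → P_3, in which every row and every column is a short exact sequence (i.e. each d_i' and each of ε_1, φ_1, κ_1 is injective, each d_i and each of ε_2, φ_2, κ_2 is surjective, and kernels equal images in the middle). Then there exist Λ-linear sections σ_i : P_i → N_i of d_i for i = 1, 2, 3 such that φ_1 ∘ σ_1 = σ_2 ∘ κ_1 and φ_2 ∘ σ_2 = σ_3 ∘ κ_2. -/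
/-- A linear map whose values lie in the range of an injective linear map `f` factors
through `f`. -/
theorem LinearMap.exists_comp_eq_of_injective {R M N P : Type*} [Ring R]
    [AddCommGroup M] [AddCommGroup N] [AddCommGroup P] [Module R M] [Module R N] [Module R P]
    (f : M →ₗ[R] N) (hf : Function.Injective f) (g : P →ₗ[R] N)
    (hg : ∀ x, g x ∈ LinearMap.range f) : ∃ r : P →ₗ[R] M, f.comp r = g := by
  refine ⟨(LinearEquiv.ofInjective f hf).symm.toLinearMap.comp (g.codRestrict _ hg), ?_⟩
  ext x
  exact congrArg Subtype.val ((LinearEquiv.ofInjective f hf).apply_symm_apply ⟨g x, hg x⟩)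

/-- Given a commutative diagram of finitely generated projective left `Λ`-modules in which
every row and every column is a short exact sequence, there exist `Λ`-linear sections
`σᵢ` of the surjections `dᵢ : Nᵢ → Pᵢ` that are compatible with the vertical maps. -/
theorem exists_compatible_sections
    (Λ : Type*) [Ring Λ]
    (M₁ M₂ M₃ N₁ N₂ N₃ P₁ P₂ P₃ : Type*)
    [AddCommGroup M₁] [AddCommGroup M₂] [AddCommGroup M₃]
    [AddCommGroup N₁] [AddCommGroup N₂] [AddCommGroup N₃]
    [AddCommGroup P₁] [AddCommGroup P₂] [AddCommGroup P₃]
    [Module Λ M₁] [Module Λ M₂] [Module Λ M₃]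
    [Module Λ N₁] [Module Λ N₂] [Module Λ N₃]
    [Module Λ P₁] [Module Λ P₂] [Module Λ P₃]
    [Module.Finite Λ M₁] [Module.Finite Λ M₂] [Module.Finite Λ M₃]
    [Module.Finite Λ N₁] [Module.Finite Λ N₂] [Module.Finite Λ N₃]
    [Module.Finite Λ P₁] [Module.Finite Λ P₂] [Module.Finite Λ P₃]
    [Module.Projective Λ M₁] [Module.Projective Λ M₂] [Module.Projective Λ M₃]
    [Module.Projective Λ N₁] [Module.Projective Λ N₂] [Module.Projective Λ N₃]
    [Module.Projective Λ P₁] [Module.Projective Λ P₂] [Module.Projective Λ P₃]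
    -- the rows
    (d₁' : M₁ →ₗ[Λ] N₁) (d₁ : N₁ →ₗ[Λ] P₁)
    (d₂' : M₂ →ₗ[Λ] N₂) (d₂ : N₂ →ₗ[Λ] P₂)
    (d₃' : M₃ →ₗ[Λ] N₃) (d₃ : N₃ →ₗ[Λ] P₃)
    -- the columns
    (ε₁ : M₁ →ₗ[Λ] M₂) (ε₂ : M₂ →ₗ[Λ] M₃)
    (φ₁ : N₁ →ₗ[Λ] N₂) (φ₂ : N₂ →ₗ[Λ] N₃)
    (κ₁ : P₁ →ₗ[Λ] P₂) (κ₂ : P₂ →ₗ[Λ] P₃)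
    -- commutativity of the diagram
    (hcomm₁ : φ₁.comp d₁' = d₂'.comp ε₁) (hcomm₂ : κ₁.comp d₁ = d₂.comp φ₁)
    (hcomm₃ : φ₂.comp d₂' = d₃'.comp ε₂) (hcomm₄ : κ₂.comp d₂ = d₃.comp φ₂)
    -- the rows are short exact sequences
    (hrow₁inj : Function.Injective d₁') (hrow₁surj : Function.Surjective d₁)
    (hrow₁ex : LinearMap.range d₁' = LinearMap.ker d₁)
    (hrow₂inj : Function.Injective d₂') (hrow₂surj : Function.Surjective d₂)
    (hrow₂ex : LinearMap.range d₂' = LinearMap.ker d₂)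
    (hrow₃inj : Function.Injective d₃') (hrow₃surj : Function.Surjective d₃)
    (hrow₃ex : LinearMap.range d₃' = LinearMap.ker d₃)
    -- the columns are short exact sequences
    (hcolMinj : Function.Injective ε₁) (hcolMsurj : Function.Surjective ε₂)
    (hcolMex : LinearMap.range ε₁ = LinearMap.ker ε₂)
    (hcolNinj : Function.Injective φ₁) (hcolNsurj : Function.Surjective φ₂)
    (hcolNex : LinearMap.range φ₁ = LinearMap.ker φ₂)
    (hcolPinj : Function.Injective κ₁) (hcolPsurj : Function.Surjective κ₂)
    (hcolPex : LinearMap.range κ₁ = LinearMap.ker κ₂) :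
    ∃ (σ₁ : P₁ →ₗ[Λ] N₁) (σ₂ : P₂ →ₗ[Λ] N₂) (σ₃ : P₃ →ₗ[Λ] N₃),
      d₁.comp σ₁ = LinearMap.id ∧ d₂.comp σ₂ = LinearMap.id ∧ d₃.comp σ₃ = LinearMap.id ∧
      φ₁.comp σ₁ = σ₂.comp κ₁ ∧ φ₂.comp σ₂ = σ₃.comp κ₂ := by
  obtain ⟨σ₁, hσ₁⟩ := Module.projective_lifting_property d₁ LinearMap.id hrow₁surj
  obtain ⟨s, hs⟩ := Module.projective_lifting_property κ₂ LinearMap.id hcolPsurj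
  obtain ⟨τ, hτ⟩ := Module.projective_lifting_property d₂ s hrow₂surj
  have hκ (x : P₁) : κ₂ (κ₁ x) = 0 := by
    rw [← LinearMap.mem_ker, ← hcolPex]
    exact LinearMap.mem_range_self κ₁ x
  have hφ (x : N₁) : φ₂ (φ₁ x) = 0 := by
    rw [← LinearMap.mem_ker, ← hcolNex]
    exact LinearMap.mem_range_self φ₁ x
  have hs' (x : P₃) : κ₂ (s x) = x := LinearMap.congr_fun hs x
  have hmem (x : P₂) : (LinearMap.id - s.comp κ₂ : P₂ →ₗ[Λ] P₂) x ∈ LinearMap.range κ₁ := by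
    simp [hcolPex, hs']
  obtain ⟨r, hr⟩ := LinearMap.exists_comp_eq_of_injective κ₁ hcolPinj _ hmem
  have hr' (x : P₂) : κ₁ (r x) = x - s (κ₂ x) := LinearMap.congr_fun hr x
  have hrκ (x : P₁) : r (κ₁ x) = x := hcolPinj (by simp [hr', hκ])
  have hd₁ (x : N₁) : d₂ (φ₁ x) = κ₁ (d₁ x) := (LinearMap.congr_fun hcomm₂ x).symm
  have hd₂ (x : N₂) : d₃ (φ₂ x) = κ₂ (d₂ x) := (LinearMap.congr_fun hcomm₄ x).symm
  have hσ (x : P₁) : d₁ (σ₁ x) = x := LinearMap.congr_fun hσ₁ x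
  have hτ' (x : P₃) : d₂ (τ x) = s x := LinearMap.congr_fun hτ x
  refine ⟨σ₁, φ₁.comp (σ₁.comp r) + τ.comp κ₂, φ₂.comp τ, hσ₁, ?_, ?_, ?_, ?_⟩ <;>
    ext x <;> simp [hd₁, hd₂, hσ, hτ', hr', hs', hκ, hφ, hrκ]
end

section
/- Let A be a commutative ring, d and d' natural numbers with 1 ≤ d ≤ d', M a d' × d matrix over A, and a a natural number with 0 ≤ a ≤ d. Let I be the ideal of A generated by the determinants of all d × d submatrices (obtained by choosing d of the d' rows) of all matrices obtained from M by replacing at most a of its d columns by arbitrary column vectors in A^{d'}. Then I is equal to the ideal of A generated by all (d−a) × (d−a) minors of M, with the convention that this is the unit ideal when a = d. -/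
theorem exists_injective_sumElim {k a n : ℕ} (hn : k + a ≤ n) {g : Fin k → Fin n}
    (hg : Function.Injective g) :
    ∃ u : Fin a → Fin n, Function.Injective (Sum.elim g u) := by
  classical
  have hc : a ≤ (Finset.univ.image g)ᶜ.card := by
    rw [Finset.card_compl, Finset.card_image_of_injective _ hg, Finset.card_univ,
      Fintype.card_fin, Fintype.card_fin]
    omega
  refine ⟨Finset.orderEmbOfCardLe _ hc, hg.sumElim (RelEmbedding.injective _) ?_⟩
  intro i b hib
  have := Finset.orderEmbOfCardLe_mem _ hc b
  rw [← hib] at this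
  simp at this

theorem Matrix.det_submatrix_mem_of_det_mem {A m n : Type*} [CommRing A] [Fintype m]
    [DecidableEq m] [Fintype n] [DecidableEq n] {J : Ideal A} (X : Matrix n n A) (e f : m ≃ n)
    (hX : X.det ∈ J) : (X.submatrix e f).det ∈ J := by
  have h : X.submatrix e f = (X.submatrix (f.symm.trans e) id).submatrix f f := by
    ext i j
    simp
  rw [h, Matrix.det_submatrix_equiv_self, Matrix.det_permute]
  exact J.mul_mem_left _ hX

/-- If all `k × k` minors of a square matrix of size `k + m` avoiding a set of at most `m`
columns lie in an ideal, then so does the determinant. -/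
theorem Matrix.det_mem_of_minors_mem {A : Type*} [CommRing A] {J : Ideal A} {k : ℕ} (m : ℕ)
    (Q : Matrix (Fin (k + m)) (Fin (k + m)) A) (s : Finset (Fin (k + m))) (hs : s.card ≤ m)
    (hQ : ∀ g h : Fin k → Fin (k + m), StrictMono g → StrictMono h → (∀ j, h j ∉ s) →
      (Q.submatrix g h).det ∈ J) : Q.det ∈ J := by
  classical
  induction m with
  | zero =>
    have hs' : s = ∅ := by simpa using hs
    simpa using hQ id id strictMono_id strictMono_id (by simp [hs'])
  | succ m ih =>
    obtain ⟨j, hj⟩ : ∃ j : Fin (k + m + 1), s.Nonempty → j ∈ s := by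
      rcases s.eq_empty_or_nonempty with h | ⟨j, hj⟩
      · exact ⟨0, by simp [h]⟩
      · exact ⟨j, fun _ => hj⟩
    rw [Matrix.det_succ_column (n := k + m) Q j]
    refine J.sum_mem fun i _ => J.mul_mem_left _ ?_
    refine ih _ (Finset.univ.filter fun l => j.succAbove l ∈ s) ?_ ?_
    · have hsub : (Finset.univ.filter fun l => j.succAbove l ∈ s).image j.succAbove
          ⊆ s.erase j := by
        intro x hx
        simp only [Finset.mem_image, Finset.mem_filter, Finset.mem_univ, true_and] at hx
        obtain ⟨l, hl, rfl⟩ := hx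
        exact Finset.mem_erase.2 ⟨Fin.succAbove_ne j l, hl⟩
      have hle := Finset.card_le_card hsub
      rw [Finset.card_image_of_injective _ Fin.succAbove_right_injective] at hle
      refine hle.trans ?_
      rcases s.eq_empty_or_nonempty with h | h
      · simp [h]
      · rw [Finset.card_erase_of_mem (hj h)]
        omega
    · intro g h hg hh hhs
      rw [Matrix.submatrix_submatrix]
      exact hQ _ _ ((Fin.strictMono_succAbove i).comp hg) ((Fin.strictMono_succAbove j).comp hh)
        fun l hl => hhs l (by simpa using hl)

/-- A `k × k` minor of `M` is, up to sign, a maximal minor of a matrix obtained from `M` by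
replacing the `a` columns not involved in the minor by standard basis vectors. -/
theorem Matrix.det_submatrix_mem_of_column_replacements {A : Type*} [CommRing A]
    {k a d d' : ℕ} (hd : k + a = d) (hdd' : d ≤ d') {J : Ideal A}
    (M : Matrix (Fin d') (Fin d) A)
    (hJ : ∀ (N : Matrix (Fin d') (Fin d) A) (s : Finset (Fin d)), s.card ≤ a →
      (∀ i, ∀ j ∉ s, N i j = M i j) → ∀ g : Fin d → Fin d', StrictMono g →
      (N.submatrix g id).det ∈ J)
    {g : Fin k → Fin d'} {h : Fin k → Fin d} (hg : Function.Injective g)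
    (hh : Function.Injective h) : (M.submatrix g h).det ∈ J := by
  classical
  obtain ⟨v, hv⟩ := exists_injective_sumElim hd.le hh
  obtain ⟨u, hu⟩ := exists_injective_sumElim (hd.trans_le hdd') hg
  have hcard : Fintype.card (Fin k ⊕ Fin a) = Fintype.card (Fin d) := by simp [hd]
  let f : Fin k ⊕ Fin a ≃ Fin d :=
    Equiv.ofBijective _ ((Fintype.bijective_iff_injective_and_card _).2 ⟨hv, hcard⟩)
  have hR : (Finset.univ.image (Sum.elim g u)).card = d := by
    rw [Finset.card_image_of_injective _ hu, Finset.card_univ, hcard, Fintype.card_fin]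
  let g' := (Finset.univ.image (Sum.elim g u)).orderEmbOfFin hR
  have he : ∀ x, ∃ y, g' y = Sum.elim g u x := by
    intro x
    have : Sum.elim g u x ∈ Set.range g' := by
      rw [Finset.range_orderEmbOfFin]
      exact Finset.mem_image_of_mem _ (Finset.mem_univ x)
    exact this
  choose e he using he
  have he_inj : Function.Injective e := fun x y hxy => hu (by rw [← he, ← he, hxy])
  let e' : Fin k ⊕ Fin a ≃ Fin d :=
    Equiv.ofBijective e ((Fintype.bijective_iff_injective_and_card _).2 ⟨he_inj, hcard⟩)
  let N : Matrix (Fin d') (Fin d) A := Matrix.of fun i j =>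
    Sum.elim (fun l => M i (h l)) (fun b => if i = u b then 1 else 0) (f.symm j)
  have hN : (N.submatrix g' id).det ∈ J := by
    refine hJ N (Finset.univ.image v) (Finset.card_image_le.trans (by simp)) ?_ g' g'.strictMono
    intro i j hj
    obtain ⟨x, rfl⟩ := f.surjective j
    rcases x with l | b
    · simp only [N, Matrix.of_apply, Equiv.symm_apply_apply, Sum.elim_inl]
      rfl
    · exact absurd (Finset.mem_image_of_mem v (Finset.mem_univ b)) hj
  have hblock : (N.submatrix g' id).submatrix e' f =
      Matrix.fromBlocks (M.submatrix g h) 0 (M.submatrix u h) 1 := by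
    have he' : ∀ x, g' (e' x) = Sum.elim g u x := he
    ext (i | i) (j | j)
    · simp [N, he']
    · have : g i ≠ u j := fun hij => by simpa using @hu (Sum.inl i) (Sum.inr j) hij
      simp [N, he', this]
    · simp [N, he']
    · have : u i = u j ↔ i = j :=
        ⟨fun hij => by simpa using @hu (Sum.inr i) (Sum.inr j) hij, congrArg u⟩
      simp [N, he', this, Matrix.one_apply]
  have := Matrix.det_submatrix_mem_of_det_mem _ e' f hN
  rwa [hblock, Matrix.det_fromBlocks_zero₁₂, Matrix.det_one, mul_one] at this

/-- Let `A` be a commutative ring, `M` a `d' × d` matrix over `A` with `1 ≤ d ≤ d'` and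
`a ≤ d`.  The ideal of `A` generated by the determinants of all `d × d` submatrices (obtained
by choosing `d` of the `d'` rows) of all matrices obtained from `M` by replacing at most `a`
of its columns by arbitrary column vectors is equal to the ideal generated by all
`(d-a) × (d-a)` minors of `M` (which is the unit ideal when `a = d`, since the empty minor
is `1`). -/
theorem span_dets_column_replacements_eq_span_minors
    (A : Type*) [CommRing A] (d d' : ℕ) (hd : 1 ≤ d) (hdd' : d ≤ d')
    (M : Matrix (Fin d') (Fin d) A) (a : ℕ) (ha : a ≤ d) :
    Ideal.span {x : A | ∃ (N : Matrix (Fin d') (Fin d) A) (s : Finset (Fin d)),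
        s.card ≤ a ∧ (∀ (i : Fin d') (j : Fin d), j ∉ s → N i j = M i j) ∧
        ∃ g : Fin d → Fin d', StrictMono g ∧ x = (N.submatrix g id).det} =
    Ideal.span {x : A | ∃ (g : Fin (d - a) → Fin d') (h : Fin (d - a) → Fin d),
        StrictMono g ∧ StrictMono h ∧ x = (M.submatrix g h).det} := by
  apply le_antisymm
  · rw [Ideal.span_le]
    rintro x ⟨N, s, hs, hN, g, hg, rfl⟩
    obtain ⟨k, rfl⟩ := Nat.exists_eq_add_of_le' ha
    rw [Nat.add_sub_cancel]
    refine Matrix.det_mem_of_minors_mem a _ s hs fun g₁ h hg₁ hh hhs => ?_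
    refine Ideal.subset_span ⟨g ∘ g₁, h, hg.comp hg₁, hh, ?_⟩
    congr 1
    ext i j
    exact hN _ _ (hhs j)
  · rw [Ideal.span_le]
    rintro x ⟨g, h, hg, hh, rfl⟩
    refine Matrix.det_submatrix_mem_of_column_replacements (Nat.sub_add_cancel ha) hdd' M ?_
      hg.injective hh.injective
    exact fun N s hs hN g' hg' => Ideal.subset_span ⟨N, s, hs, hN, g', hg', rfl⟩
end

section
/- Let K be a number field inside a fixed algebraic closure ℚ^c of ℚ and let 𝒦 be a (possibly infinite) Galois extension of K inside ℚ^c. For a natural number n, let K_(n) denote the compositum, inside 𝒦, of all finite extensions L of K with L ⊆ 𝒦 such that the absolute value of the discriminant of L over ℚ is at most n. Then K_(n) is a finite Galois extension of K, and every finite extension of K inside 𝒦 is contained in K_(n) for some natural number n. -/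
namespace IntermediateField

open NumberField

variable {K 𝒦 : Type*} [Field K] [Field 𝒦] [Algebra K 𝒦]

variable (K 𝒦) in
/-- The intermediate fields of `𝒦/K` that are number fields of absolute discriminant at most
`n`. -/
def discrBdd (n : ℕ) : Set (IntermediateField K 𝒦) :=
  {L | ∃ _ : NumberField L, (discr L).natAbs ≤ n}

/-- **Hermite's theorem** for intermediate fields of an arbitrary extension of a number field. -/
theorem finite_discrBdd [NumberField K] (n : ℕ) : (discrBdd K 𝒦 n).Finite := by
  have : CharZero 𝒦 := charZero_of_injective_algebraMap (algebraMap K 𝒦).injective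
  refine Set.Finite.subset (((finite_of_discr_bdd 𝒦 n).image Subtype.val).preimage
    (restrictScalars_injective ℚ (L := 𝒦) (L' := K)).injOn) ?_
  rintro L ⟨hL, hn⟩
  have hfin : FiniteDimensional ℚ (L.restrictScalars ℚ) := hL.to_finiteDimensional
  refine ⟨⟨L.restrictScalars ℚ, hfin⟩, ?_, rfl⟩
  change |discr L| ≤ n
  rw [Int.abs_eq_natAbs]
  exact_mod_cast hn

theorem map_mem_discrBdd {n : ℕ} {L : IntermediateField K 𝒦} (hL : L ∈ discrBdd K 𝒦 n)
    (σ : 𝒦 →ₐ[K] 𝒦) : L.map σ ∈ discrBdd K 𝒦 n := by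
  obtain ⟨hL, hn⟩ := hL
  have e : L ≃+* L.map σ := (L.equivMap σ).toRingEquiv
  have hM : NumberField (L.map σ) := NumberField.of_ringEquiv L _ e
  exact ⟨hM, by rwa [← discr_eq_discr_of_ringEquiv L e]⟩

theorem finiteDimensional_sSup_discrBdd [NumberField K] (n : ℕ) :
    FiniteDimensional K ↥(sSup (discrBdd K 𝒦 n)) := by
  have := (finite_discrBdd (K := K) (𝒦 := 𝒦) n).to_subtype
  have (L : discrBdd K 𝒦 n) : FiniteDimensional K L.1 := by
    obtain ⟨L, hL, -⟩ := L
    have : CharZero 𝒦 := charZero_of_injective_algebraMap (algebraMap K 𝒦).injective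
    exact Module.Finite.of_restrictScalars_finite ℚ K L
  rw [sSup_eq_iSup']
  exact finiteDimensional_iSup_of_finite

theorem isGalois_sSup_discrBdd [IsGalois K 𝒦] (n : ℕ) :
    IsGalois K ↥(sSup (discrBdd K 𝒦 n)) := by
  have : Normal K ↥(sSup (discrBdd K 𝒦 n)) := by
    rw [normal_iff_forall_map_le]
    intro σ
    rw [sSup_eq_iSup', map_iSup]
    exact iSup_le fun L ↦ le_iSup_of_le ⟨_, map_mem_discrBdd L.2 σ⟩ le_rfl
  exact ⟨⟩

end IntermediateField

/-- Let `K` be a number field and `𝒦` a (possibly infinite) Galois extension of `K`.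
For each natural number `n` there is an intermediate field `K_(n)` of `𝒦/K` which is the
compositum of all finite extensions `L` of `K` inside `𝒦` whose absolute discriminant over `ℚ`
is at most `n` (i.e. `K_(n)` contains every such `L` and is contained in any intermediate
field containing every such `L`); moreover `K_(n)` is a finite Galois extension of `K`, and
every finite extension of `K` inside `𝒦` is contained in `K_(n)` for some `n`. -/
theorem exists_boundedDiscriminant_compositum_tower
    (K : Type*) [Field K] [NumberField K]
    (𝒦 : Type*) [Field 𝒦] [Algebra K 𝒦] [IsGalois K 𝒦] :
    ∃ Kn : ℕ → IntermediateField K 𝒦,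
      (∀ n : ℕ,
        FiniteDimensional K ↥(Kn n) ∧
        IsGalois K ↥(Kn n) ∧
        (∀ (L : IntermediateField K 𝒦) [NumberField ↥L],
            (NumberField.discr ↥L).natAbs ≤ n → L ≤ Kn n) ∧
        (∀ E : IntermediateField K 𝒦,
            (∀ (L : IntermediateField K 𝒦) [NumberField ↥L],
              (NumberField.discr ↥L).natAbs ≤ n → L ≤ E) →
            Kn n ≤ E)) ∧
      (∀ L : IntermediateField K 𝒦, FiniteDimensional K ↥L → ∃ n : ℕ, L ≤ Kn n) := by
  refine ⟨fun n ↦ sSup (IntermediateField.discrBdd K 𝒦 n), fun n ↦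
    ⟨IntermediateField.finiteDimensional_sSup_discrBdd n,
      IntermediateField.isGalois_sSup_discrBdd n, fun L hL hn ↦ le_sSup ⟨hL, hn⟩,
      fun E hE ↦ sSup_le ?_⟩, fun L hL ↦ ?_⟩
  · rintro L ⟨_, hn⟩
    exact hE L hn
  · have : NumberField L := NumberField.of_module_finite K L
    exact ⟨_, le_sSup ⟨this, le_rfl⟩⟩
end
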